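/- The invariant ring R₂^{SL₂} is a free module over the subalgebra 𝒜 of rank q(q²−1). -/

import Mathlib

open MvPolynomial

noncomputable section

abbrev R2 (F : Type) [Field F] : Type := MvPolynomial (Fin 4) F

/-- The action of `A ∈ GL₂(F)` on `R₂ = F[x₁,x₂,y₁,y₂]` (variables `X 0, X 1, X 2, X 3`). -/
def act {F : Type} [Field F] (A : GL (Fin 2) F) : R2 F →ₐ[F] R2 F :=
  aeval ![C ((A.val.det)⁻¹ * A.val 1 1) * X 0 - C ((A.val.det)⁻¹ * A.val 1 0) * X 1,
          C ((A.val.det)⁻¹ * A.val 0 0) * X 1 - C ((A.val.det)⁻¹ * A.val 0 1) * X 0,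
          C (A.val 0 0) * X 2 + C (A.val 0 1) * X 3,
          C (A.val 1 0) * X 2 + C (A.val 1 1) * X 3]

/-- The invariant ring `R₂^G` for a subgroup `G ≤ GL₂(F)`. -/
def invariantRing {F : Type} [Field F] (G : Subgroup (GL (Fin 2) F)) : Subalgebra F (R2 F) where
  carrier := {f | ∀ A ∈ G, act A f = f}
  mul_mem' := fun hf hg A hA => by rw [map_mul, hf A hA, hg A hA]
  add_mem' := fun hf hg A hA => by rw [map_add, hf A hA, hg A hA]
  one_mem' := fun A _ => map_one (act A)
  zero_mem' := fun A _ => map_zero (act A)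
  algebraMap_mem' := fun r A _ => (act A).commutes r

/-- `SL₂(F)` as a subgroup of `GL₂(F)`. -/
def SL2 (F : Type) [Field F] : Subgroup (GL (Fin 2) F) where
  carrier := {A | A.val.det = 1}
  one_mem' := by simp
  mul_mem' := by
    intro a b ha hb
    simp only [Set.mem_setOf_eq, Units.val_mul, Matrix.det_mul] at *
    rw [ha, hb, mul_one]
  inv_mem' := by
    intro a ha
    have h : ((a⁻¹).val * a.val).det = 1 := by
      rw [← Units.val_mul, inv_mul_cancel, Units.val_one, Matrix.det_one]
    simp only [Matrix.det_mul] at h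
    rw [Set.mem_setOf_eq] at ha ⊢
    rw [ha, mul_one] at h
    exact h

/-- `P₂(F)`: upper triangular matrices in `SL₂(F)` with 1's on the diagonal. -/
def P2 (F : Type) [Field F] : Subgroup (GL (Fin 2) F) where
  carrier := {A | A.val 0 0 = 1 ∧ A.val 1 1 = 1 ∧ A.val 1 0 = 0}
  one_mem' := by simp
  mul_mem' := by
    intro a b ha hb
    obtain ⟨ha1, ha2, ha3⟩ := ha
    obtain ⟨hb1, hb2, hb3⟩ := hb
    refine ⟨?_, ?_, ?_⟩ <;>
      simp [Units.val_mul, Matrix.mul_apply, Fin.sum_univ_two, ha1, ha2, ha3, hb1, hb2, hb3]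
  inv_mem' := by
    intro a ha
    obtain ⟨ha1, ha2, ha3⟩ := ha
    have hdet : a.val.det = 1 := by
      rw [Matrix.det_fin_two, ha1, ha2, ha3]; ring
    have hinv : (a⁻¹).val = a.val⁻¹ := by
      simp [Matrix.coe_units_inv]
    refine ⟨?_, ?_, ?_⟩ <;>
      simp [hinv, Matrix.inv_def, hdet, Matrix.adjugate_fin_two, ha1, ha2, ha3]

def d22 (F : Type) [Field F] (q : ℕ) : R2 F := X 1 * X 0 ^ q - X 0 * X 1 ^ q
def d22s (F : Type) [Field F] (q : ℕ) : R2 F := X 2 * X 3 ^ q - X 3 * X 2 ^ q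
def u0 (F : Type) [Field F] : R2 F := X 0 * X 2 + X 1 * X 3
def u1 (F : Type) [Field F] (q : ℕ) : R2 F := X 0 ^ q * X 2 + X 1 ^ q * X 3
def u1s (F : Type) [Field F] (q : ℕ) : R2 F := X 0 * X 2 ^ q + X 1 * X 3 ^ q
def phi1 (F : Type) [Field F] : R2 F := X 0
def phi2 (F : Type) [Field F] (q : ℕ) : R2 F := X 1 ^ q - X 1 * X 0 ^ (q - 1)
def phi1s (F : Type) [Field F] : R2 F := X 3
def phi2s (F : Type) [Field F] (q : ℕ) : R2 F := X 2 ^ q - X 2 * X 3 ^ (q - 1)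

/-! ### Graded subspaces of a polynomial ring -/

/-- The substitution `Xᵢ ↦ Xᵢ T`, whose coefficients are the homogeneous components. -/
def homogenizing (σ F : Type) [Field F] :
    MvPolynomial σ F →ₐ[F] Polynomial (MvPolynomial σ F) :=
  aeval fun i => Polynomial.C (X i) * Polynomial.X

lemma coeff_homogenizing {σ F : Type} [Field F] (f : MvPolynomial σ F) (n : ℕ) :
    (homogenizing σ F f).coeff n = homogeneousComponent n f := by
  induction f using MvPolynomial.monomial_add_induction_on with
  | C a =>
    rw [← MvPolynomial.algebraMap_eq, AlgHom.commutes]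
    rw [MvPolynomial.algebraMap_eq, homogeneousComponent_of_mem (isHomogeneous_C σ a)]
    rw [IsScalarTower.algebraMap_apply F (MvPolynomial σ F) (Polynomial (MvPolynomial σ F)),
      Polynomial.algebraMap_apply, Polynomial.coeff_C]
    rfl
  | monomial_add a b f _ _ ih =>
    rw [map_add, Polynomial.coeff_add, ih, map_add]
    congr 1
    have h : homogenizing σ F (monomial a b)
        = Polynomial.C (monomial a b) * Polynomial.X ^ a.degree := by
      rw [homogenizing, aeval_monomial, Finsupp.prod]
      simp_rw [mul_pow]
      rw [Finset.prod_mul_distrib, Finset.prod_pow_eq_pow_sum, ← mul_assoc]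
      congr 1
      rw [monomial_eq, map_mul, Finsupp.prod, map_prod]
      simp_rw [map_pow]
      rfl
    rw [h, Polynomial.coeff_C_mul_X_pow,
      homogeneousComponent_of_mem (isHomogeneous_monomial b rfl)]

lemma homogeneousComponent_mul {σ F : Type} [Field F] (f g : MvPolynomial σ F) (n : ℕ) :
    homogeneousComponent n (f * g) = ∑ p ∈ Finset.HasAntidiagonal.antidiagonal n,
      homogeneousComponent p.1 f * homogeneousComponent p.2 g := by
  simp_rw [← coeff_homogenizing, map_mul, Polynomial.coeff_mul]

/-- A set of polynomials is graded if it contains the homogeneous components of its elements. -/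
def IsGraded {σ F : Type} [Field F] (S : Set (MvPolynomial σ F)) : Prop :=
  ∀ f ∈ S, ∀ n, homogeneousComponent n f ∈ S

lemma isGraded_adjoin {σ F : Type} [Field F] {s : Set (MvPolynomial σ F)}
    (hs : ∀ f ∈ s, ∃ n, f.IsHomogeneous n) :
    IsGraded (Algebra.adjoin F s : Set (MvPolynomial σ F)) := by
  intro f hf
  induction hf using Algebra.adjoin_induction with
  | mem x hx =>
    intro n
    obtain ⟨k, hk⟩ := hs x hx
    rw [homogeneousComponent_of_mem hk]
    split_ifs
    · exact Algebra.subset_adjoin hx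
    · exact zero_mem _
  | algebraMap r =>
    intro n
    rw [MvPolynomial.algebraMap_eq, homogeneousComponent_of_mem (isHomogeneous_C σ r)]
    split_ifs
    · exact Subalgebra.algebraMap_mem _ r
    · exact zero_mem _
  | add x y _ _ hx hy =>
    intro n
    rw [map_add]
    exact add_mem (hx n) (hy n)
  | mul x y _ _ hx hy =>
    intro n
    rw [homogeneousComponent_mul]
    exact sum_mem fun p _ => mul_mem (hx _) (hy _)

lemma isGraded_span {σ F : Type} [Field F] {A : Subalgebra F (MvPolynomial σ F)}
    (hA : IsGraded (A : Set (MvPolynomial σ F))) {s : Set (MvPolynomial σ F)}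
    (hs : ∀ f ∈ s, ∃ n, f.IsHomogeneous n) :
    IsGraded (Submodule.span A s : Set (MvPolynomial σ F)) := by
  intro f hf
  induction hf using Submodule.span_induction with
  | mem x hx =>
    intro n
    obtain ⟨k, hk⟩ := hs x hx
    rw [homogeneousComponent_of_mem hk]
    split_ifs
    · exact Submodule.subset_span hx
    · exact zero_mem _
  | zero => intro n; rw [map_zero]; exact zero_mem _
  | add x y _ _ hx hy =>
    intro n
    rw [map_add]
    exact add_mem (hx n) (hy n)
  | smul a x _ hx =>
    intro n
    rw [Subalgebra.smul_def, smul_eq_mul, homogeneousComponent_mul]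
    exact sum_mem fun p _ => Submodule.smul_mem _ (⟨_, hA a a.2 p.1⟩ : A) (hx p.2)

/-- The `F`-subspace `A₊N`, where `A₊` consists of the elements of `A` without constant term. -/
def augmentationSpan {σ F : Type} [Field F] (A : Subalgebra F (MvPolynomial σ F))
    (N : Submodule A (MvPolynomial σ F)) : Submodule F (MvPolynomial σ F) :=
  Submodule.span F {z | ∃ a ∈ A, coeff 0 a = 0 ∧ ∃ n ∈ N, z = a * n}

/-- Graded Nakayama lemma. -/
lemma le_of_le_add_augmentationSpan {σ F : Type} [Field F]
    {A : Subalgebra F (MvPolynomial σ F)} (hA : IsGraded (A : Set (MvPolynomial σ F)))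
    {M Q : Submodule A (MvPolynomial σ F)}
    (hQ : IsGraded (Q : Set (MvPolynomial σ F)))
    (h : ∀ m ∈ M, ∃ s ∈ Q, m - s ∈ augmentationSpan A M) : M ≤ Q := by
  have key : ∀ n, ∀ m ∈ M, homogeneousComponent n m ∈ Q := by
    intro n
    induction n using Nat.strong_induction_on with
    | _ n ih =>
    have hz : ∀ z ∈ augmentationSpan A M, homogeneousComponent n z ∈ Q := by
      intro z hz
      induction hz using Submodule.span_induction with
      | mem x hx =>
        obtain ⟨a, ha, ha0, m, hm, rfl⟩ := hx
        rw [homogeneousComponent_mul]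
        refine sum_mem fun p hp => ?_
        rw [Finset.HasAntidiagonal.mem_antidiagonal] at hp
        rcases Nat.eq_zero_or_pos p.1 with h0 | h0
        · rw [h0, homogeneousComponent_zero, ha0, map_zero, zero_mul]
          exact zero_mem _
        · exact Q.smul_mem (⟨_, hA a ha p.1⟩ : A) (ih p.2 (by omega) m hm)
      | zero => rw [map_zero]; exact zero_mem _
      | add x y _ _ hx hy => rw [map_add]; exact add_mem hx hy
      | smul c x _ hx =>
        rw [map_smul]
        exact Q.smul_of_tower_mem c hx
    intro m hm
    obtain ⟨s, hs, hms⟩ := h m hm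
    have := add_mem (hQ s hs n) (hz _ hms)
    rwa [← map_add, add_sub_cancel] at this
  intro m hm
  rw [← sum_homogeneousComponent m]
  exact sum_mem fun n _ => key n m hm

lemma mem_span_homogeneous {σ F : Type} [Field F] {S : Set (MvPolynomial σ F)}
    (hS : IsGraded S) {f : MvPolynomial σ F} (hf : f ∈ S) :
    f ∈ Submodule.span F {g | g ∈ S ∧ ∃ n, g.IsHomogeneous n} := by
  rw [← sum_homogeneousComponent f]
  exact sum_mem fun n _ =>
    Submodule.subset_span ⟨hS f hf n, n, homogeneousComponent_isHomogeneous n f⟩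

/-- A graded direct summand `M` of a finite graded module `N` over a graded algebra `A` is free,
provided that `N` is generated by as many elements as its rank. -/
theorem exists_linearIndependent_span_of_retract {σ F : Type} [Field F]
    {A : Subalgebra F (MvPolynomial σ F)} (hA : IsGraded (A : Set (MvPolynomial σ F)))
    {M N : Submodule A (MvPolynomial σ F)} (hMN : M ≤ N)
    (hM : IsGraded (M : Set (MvPolynomial σ F))) (hN : IsGraded (N : Set (MvPolynomial σ F)))
    (π : MvPolynomial σ F →ₗ[A] MvPolynomial σ F) (hπN : ∀ n ∈ N, π n ∈ M)
    (hπM : ∀ m ∈ M, π m = m) (S : Finset (MvPolynomial σ F))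
    (hSN : N = Submodule.span A (S : Set (MvPolynomial σ F)))
    (hS : S.card ≤ Module.finrank A N) :
    ∃ B : Finset (MvPolynomial σ F), (B : Set (MvPolynomial σ F)) ⊆ M ∧
      M ≤ Submodule.span A (B : Set (MvPolynomial σ F)) ∧
      LinearIndependent A (fun b : (B : Set (MvPolynomial σ F)) => (b : MvPolynomial σ F)) := by
  set Z := augmentationSpan A N with hZ
  have hmk : ∀ n ∈ N, Z.mkQ n ∈ Submodule.span F (Z.mkQ '' (S : Set (MvPolynomial σ F))) := by
    intro n hn
    rw [hSN] at hn
    induction hn using Submodule.span_induction with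
    | mem x hx => exact Submodule.subset_span ⟨x, hx, rfl⟩
    | zero => rw [map_zero]; exact zero_mem _
    | add x y _ _ hx hy => rw [map_add]; exact add_mem hx hy
    | smul a x hx ih =>
      have : Z.mkQ (a • x) = coeff 0 (a : MvPolynomial σ F) • Z.mkQ x := by
        rw [← map_smul, ← sub_eq_zero, ← map_sub, ← LinearMap.mem_ker, Submodule.ker_mkQ]
        refine Submodule.subset_span
          ⟨a - algebraMap F _ (coeff 0 (a : MvPolynomial σ F)),
            sub_mem a.2 (Subalgebra.algebraMap_mem _ _), by simp [MvPolynomial.algebraMap_eq],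
            x, by rw [hSN]; exact hx, ?_⟩
        rw [sub_mul, ← Algebra.smul_def]
        rfl
      rw [this]
      exact Submodule.smul_mem _ _ ih
  obtain ⟨B, hBM, -, hBspan, hBind⟩ := exists_linearIndepOn_extension (K := F) (v := Z.mkQ)
    (linearIndepOn_empty F _)
    (Set.empty_subset {g | g ∈ (M : Set (MvPolynomial σ F)) ∧ ∃ n, g.IsHomogeneous n})
  obtain ⟨B', hBN, hBB, hBspan', hBind'⟩ := exists_linearIndepOn_extension (K := F) hBind
    (show B ⊆ {g | g ∈ (N : Set (MvPolynomial σ F)) ∧ ∃ n, g.IsHomogeneous n} from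
      fun g hg => ⟨hMN (hBM hg).1, (hBM hg).2⟩)
  classical
  have hcard := linearIndependent_le_span' (R := F) _ hBind'
    (S.image Z.mkQ : Finset _) (by
      rintro _ ⟨b, rfl⟩
      have := hmk b.1 (hBN b.2).1
      simpa using this)
  have hfin : B'.Finite := by
    rw [← Set.finite_coe_iff, ← Cardinal.lt_aleph0_iff_finite]
    exact hcard.trans_lt (Cardinal.natCast_lt_aleph0)
  lift B' to Finset (MvPolynomial σ F) using hfin
  have hcard' : B'.card ≤ S.card := by
    refine le_trans ?_ (Finset.card_image_le (f := Z.mkQ) (s := S))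
    simpa using hcard
  -- every element is congruent to a combination of the chosen elements
  have cong : ∀ (K : Submodule A (MvPolynomial σ F)) (T : Set (MvPolynomial σ F)),
      IsGraded (K : Set (MvPolynomial σ F)) →
      Z.mkQ '' {g | g ∈ (K : Set (MvPolynomial σ F)) ∧ ∃ n, g.IsHomogeneous n}
        ⊆ Submodule.span F (Z.mkQ '' T) →
      ∀ m ∈ K, ∃ s ∈ Submodule.span F T, m - s ∈ Z := by
    intro K T hK hT m hm
    have h1 : Z.mkQ m ∈ Submodule.span F (Z.mkQ '' T) := by
      refine Submodule.span_le.2 hT ?_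
      rw [← Submodule.map_span]
      exact Submodule.mem_map_of_mem (mem_span_homogeneous hK hm)
    rw [← Submodule.map_span] at h1
    obtain ⟨s, hs, hsm⟩ := h1
    refine ⟨s, hs, ?_⟩
    rw [← Submodule.ker_mkQ Z, LinearMap.mem_ker, map_sub, hsm, sub_self]
  have hres : ∀ (T : Set (MvPolynomial σ F)), ∀ s ∈ Submodule.span F T,
      s ∈ Submodule.span A T := fun T s hs =>
    Submodule.span_le_restrictScalars F A T hs
  have hNspan : N ≤ Submodule.span A (B' : Set (MvPolynomial σ F)) := by
    refine le_of_le_add_augmentationSpan hA (isGraded_span hA fun f hf => (hBN hf).2) ?_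
    intro m hm
    obtain ⟨s, hs, hz⟩ := cong N B' hN hBspan' m hm
    exact ⟨s, hres _ s hs, hz⟩
  have hNeq : Submodule.span A (B' : Set (MvPolynomial σ F)) = N :=
    le_antisymm (Submodule.span_le.2 fun b hb => (hBN hb).1) hNspan
  have hind : LinearIndependent A
      (fun b : (B' : Set (MvPolynomial σ F)) => (b : MvPolynomial σ F)) := by
    rw [linearIndependent_iff_card_le_finrank_span, Set.finrank, Subtype.range_coe, hNeq]
    simpa using hcard'.trans hS
  have hBfin : B.Finite := B'.finite_toSet.subset hBB
  lift B to Finset (MvPolynomial σ F) using hBfin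
  refine ⟨B, fun b hb => (hBM hb).1, ?_, LinearIndepOn.mono (v := id) hind hBB⟩
  refine le_of_le_add_augmentationSpan hA (isGraded_span hA fun f hf => (hBM hf).2) ?_
  intro m hm
  obtain ⟨s, hs, hz⟩ := cong M B hM hBspan m hm
  refine ⟨s, hres _ s hs, ?_⟩
  have hsM : s ∈ M := Submodule.span_le.2 (fun b hb => (hBM hb).1) (hres _ s hs)
  rw [← hπM _ (sub_mem hm hsM)]
  rw [hZ] at hz
  generalize m - s = z at hz
  induction hz using Submodule.span_induction with
  | mem x hx =>
    obtain ⟨a, ha, ha0, n, hn, rfl⟩ := hx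
    refine Submodule.subset_span ⟨a, ha, ha0, π n, hπN n hn, ?_⟩
    exact π.map_smul (⟨a, ha⟩ : A) n
  | zero => rw [map_zero]; exact zero_mem _
  | add x y _ _ hx hy => rw [map_add]; exact add_mem hx hy
  | smul c x _ hx =>
    have : π (c • x) = c • π x := π.map_smul_of_tower c x
    rw [this]
    exact Submodule.smul_mem _ _ hx

/-! ### Ranks of invariant rings -/

lemma card_eq_finrank_of_fixed {F R Γ : Type} [Field F] [CommRing R] [IsDomain R] [Algebra F R]
    [Group Γ] [Finite Γ] (φ : Γ →* (R ≃ₐ[F] R)) (hφ : Function.Injective φ)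
    (D : Subalgebra F R) (hD : ∀ f, f ∈ D ↔ ∀ g, φ g f = f) :
    Nat.card Γ = Module.finrank D R := by
  let _ : MulSemiringAction Γ R := MulSemiringAction.compHom R φ
  have hsmul : ∀ (g : Γ) (f : R), g • f = φ g f := fun _ _ => rfl
  have : IsGaloisGroup Γ D R :=
    { faithful := ⟨fun {a b} h => hφ (AlgEquiv.ext fun f => h f)⟩
      commutes := ⟨fun g a f => by
        rw [hsmul, hsmul, Subalgebra.smul_def, Subalgebra.smul_def, smul_eq_mul, smul_eq_mul,
          map_mul, (hD a).1 a.2 g]⟩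
      isInvariant := ⟨fun b hb => ⟨⟨b, (hD b).2 hb⟩, rfl⟩⟩ }
  exact IsGaloisGroup.card_eq_finrank' Γ D R

lemma finrank_mul_finrank_of_le {F R : Type} [Field F] [CommRing R] [IsDomain R] [Algebra F R]
    {A D : Subalgebra F R} (hAD : A ≤ D) (D' : Submodule A R) (h : ∀ f, f ∈ D' ↔ f ∈ D) :
    Module.finrank A D' * Module.finrank D R = Module.finrank A R := by
  let _ : Algebra A D := (Subalgebra.inclusion hAD).toRingHom.toAlgebra
  have : IsScalarTower A D R := IsScalarTower.of_algebraMap_eq fun _ => rfl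
  have e : D ≃ₗ[A] D' :=
    { toFun := fun x => ⟨x, (h x).2 x.2⟩
      invFun := fun x => ⟨x, (h x).1 x.2⟩
      map_add' := fun _ _ => rfl
      map_smul' := fun _ _ => rfl
      left_inv := fun _ => rfl
      right_inv := fun _ => rfl }
  rw [← e.finrank_eq]
  exact Module.finrank_mul_finrank' (R := A) (S := D) R

lemma finrank_le_card_of_span {F R : Type} [Field F] [CommRing R] [IsDomain R] [Algebra F R]
    (A : Subalgebra F R) (S : Finset R) (hS : Submodule.span A (S : Set R) = ⊤) :
    Module.finrank A R ≤ S.card := by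
  rw [← finrank_top, ← hS]
  exact finrank_span_finset_le_card S

lemma finrank_pos_of_span {F R : Type} [Field F] [CommRing R] [IsDomain R] [Algebra F R]
    (A : Subalgebra F R) (S : Finset R) (hS : Submodule.span A (S : Set R) = ⊤) :
    0 < Module.finrank A R := by
  have : Module.Finite A R := ⟨⟨S, hS⟩⟩
  exact Module.finrank_pos

/-! ### The action of pairs of matrices -/

/-- The action of a pair of matrices: the first one acts on `x₁, x₂` through the transpose of its
adjugate, the second one acts on `y₁, y₂`. -/
def pairAct {F : Type} [Field F] (A B : GL (Fin 2) F) : R2 F →ₐ[F] R2 F :=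
  aeval ![C (A.val 1 1) * X 0 - C (A.val 1 0) * X 1,
          C (A.val 0 0) * X 1 - C (A.val 0 1) * X 0,
          C (B.val 0 0) * X 2 + C (B.val 0 1) * X 3,
          C (B.val 1 0) * X 2 + C (B.val 1 1) * X 3]

section pairAct

variable {F : Type} [Field F]

lemma pairAct_X0 (A B : GL (Fin 2) F) :
    pairAct A B (X 0) = C (A.val 1 1) * X 0 - C (A.val 1 0) * X 1 := by simp [pairAct]

lemma pairAct_X1 (A B : GL (Fin 2) F) :
    pairAct A B (X 1) = C (A.val 0 0) * X 1 - C (A.val 0 1) * X 0 := by simp [pairAct]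

lemma pairAct_X2 (A B : GL (Fin 2) F) :
    pairAct A B (X 2) = C (B.val 0 0) * X 2 + C (B.val 0 1) * X 3 := by simp [pairAct]

lemma pairAct_X3 (A B : GL (Fin 2) F) :
    pairAct A B (X 3) = C (B.val 1 0) * X 2 + C (B.val 1 1) * X 3 := by simp [pairAct]

lemma pairAct_C (A B : GL (Fin 2) F) (c : F) : pairAct A B (C c) = C c := by simp [pairAct]

lemma act_eq_pairAct {A : GL (Fin 2) F} (hA : A ∈ SL2 F) : act A = pairAct A A := by
  have h : A.val.det = 1 := hA
  unfold act pairAct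
  simp [h]

lemma pairAct_comp (A B A' B' : GL (Fin 2) F) (f : R2 F) :
    pairAct A B (pairAct A' B' f) = pairAct (A' * A) (B' * B) f := by
  change ((pairAct A B).comp (pairAct A' B')) f = _
  congr 1
  ext1 i
  fin_cases i <;>
  simp only [AlgHom.comp_apply, Fin.zero_eta, Fin.mk_one, Fin.reduceFinMk, pairAct_X0, pairAct_X1,
    pairAct_X2, pairAct_X3, map_sub, map_add, map_mul, pairAct_C, Units.val_mul, Matrix.mul_apply,
    Fin.sum_univ_two] <;>
  ring

lemma pairAct_one (f : R2 F) : pairAct 1 1 f = f := by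
  change pairAct 1 1 f = AlgHom.id F _ f
  congr 1
  ext1 i
  fin_cases i <;> simp [pairAct_X0, pairAct_X1, pairAct_X2, pairAct_X3]

lemma eq_one_of_pairAct {A B : GL (Fin 2) F} (h : ∀ f, pairAct A B f = f) : A = 1 ∧ B = 1 := by
  have hx := fun v : Fin 4 → F => congrArg (eval v) (h (X 0))
  have hx' := fun v : Fin 4 → F => congrArg (eval v) (h (X 1))
  have hy := fun v : Fin 4 → F => congrArg (eval v) (h (X 2))
  have hy' := fun v : Fin 4 → F => congrArg (eval v) (h (X 3))
  simp only [pairAct_X0, pairAct_X1, pairAct_X2, pairAct_X3, map_sub, map_add, map_mul, eval_C,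
    eval_X] at hx hx' hy hy'
  have hx1 := hx ![1, 0, 0, 0]
  have hx2 := hx ![0, 1, 0, 0]
  have hx3 := hx' ![1, 0, 0, 0]
  have hx4 := hx' ![0, 1, 0, 0]
  have hy1 := hy ![0, 0, 1, 0]
  have hy2 := hy ![0, 0, 0, 1]
  have hy3 := hy' ![0, 0, 1, 0]
  have hy4 := hy' ![0, 0, 0, 1]
  simp at hx1 hx2 hx3 hx4 hy1 hy2 hy3 hy4
  constructor <;> ext i j <;> fin_cases i <;> fin_cases j <;> simp [*]

/-- The automorphism of `R₂` defined by a pair of matrices. -/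
def pairAut : GL (Fin 2) F × GL (Fin 2) F →* (R2 F ≃ₐ[F] R2 F) where
  toFun p := AlgEquiv.ofAlgHom (pairAct p.1⁻¹ p.2⁻¹) (pairAct p.1 p.2)
    (AlgHom.ext fun f => by simp [pairAct_comp, pairAct_one])
    (AlgHom.ext fun f => by simp [pairAct_comp, pairAct_one])
  map_one' := AlgEquiv.ext fun f => by simp [pairAct_one]
  map_mul' p p' := AlgEquiv.ext fun f => by simp [pairAct_comp]

lemma pairAut_apply (p : GL (Fin 2) F × GL (Fin 2) F) (f : R2 F) :
    pairAut p f = pairAct p.1⁻¹ p.2⁻¹ f := rfl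

lemma pairAut_injective : Function.Injective (pairAut (F := F)) := by
  rw [injective_iff_map_eq_one]
  intro p hp
  have := eq_one_of_pairAct (A := p.1⁻¹) (B := p.2⁻¹) fun f => by
    rw [← pairAut_apply, hp]; rfl
  exact Prod.ext (inv_eq_one.1 this.1) (inv_eq_one.1 this.2)

lemma P2_le_SL2 : P2 F ≤ SL2 F := by
  intro A hA
  obtain ⟨h1, h2, h3⟩ := hA
  change A.val.det = 1
  rw [Matrix.det_fin_two, h1, h2, h3]
  ring

lemma mem_invariantRing_iff {G : Subgroup (GL (Fin 2) F)} (hG : G ≤ SL2 F) (f : R2 F) :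
    f ∈ invariantRing G ↔ ∀ A ∈ G, pairAct A A f = f :=
  forall₂_congr fun A hA => by rw [act_eq_pairAct (hG hA)]

lemma card_eq_finrank_invariantRing [Finite F] {G : Subgroup (GL (Fin 2) F)} (hG : G ≤ SL2 F) :
    Nat.card G = Module.finrank (invariantRing G) (R2 F) := by
  have : Finite G := Subtype.finite
  refine card_eq_finrank_of_fixed (Γ := G) (pairAut.comp (G.subtype.prod G.subtype)) ?_ _ ?_
  · refine pairAut_injective.comp fun a b hab => Subtype.ext ?_
    exact congrArg Prod.fst hab
  · intro f
    rw [mem_invariantRing_iff hG]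
    constructor
    · exact fun h g => h _ (inv_mem g.2)
    · intro h A hA
      simpa [pairAut_apply] using h (⟨A, hA⟩ : G)⁻¹

/-- The invariants of `SL₂ × SL₂`. -/
def pairInvariants (F : Type) [Field F] : Subalgebra F (R2 F) where
  carrier := {f | ∀ A ∈ SL2 F, ∀ B ∈ SL2 F, pairAct A B f = f}
  mul_mem' := fun hf hg A hA B hB => by rw [map_mul, hf A hA B hB, hg A hA B hB]
  add_mem' := fun hf hg A hA B hB => by rw [map_add, hf A hA B hB, hg A hA B hB]
  algebraMap_mem' := fun r A _ B _ => (pairAct A B).commutes r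

lemma pairInvariants_le_invariantRing {G : Subgroup (GL (Fin 2) F)} (hG : G ≤ SL2 F) :
    pairInvariants F ≤ invariantRing G := by
  intro f hf
  rw [mem_invariantRing_iff hG]
  exact fun A hA => hf A (hG hA) A (hG hA)

lemma card_sq_eq_finrank_pairInvariants [Finite F] :
    Nat.card (SL2 F) ^ 2 = Module.finrank (pairInvariants F) (R2 F) := by
  rw [sq, ← Nat.card_prod]
  refine card_eq_finrank_of_fixed (pairAut.comp ((SL2 F).subtype.prodMap (SL2 F).subtype)) ?_ _ ?_
  · exact pairAut_injective.comp
      (Function.Injective.prodMap (Subgroup.subtype_injective _) (Subgroup.subtype_injective _))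
  · intro f
    constructor
    · exact fun h g => h _ (inv_mem g.1.2) _ (inv_mem g.2.2)
    · intro h A hA B hB
      simpa [pairAut_apply] using h (⟨A, hA⟩, ⟨B, hB⟩)⁻¹

/-! ### Group orders -/

lemma card_P2 : Nat.card (P2 F) = Nat.card F := by
  refine Nat.card_congr
    { toFun := fun A => A.1.val 0 1
      invFun := fun b => ⟨Matrix.GeneralLinearGroup.mkOfDetNeZero !![1, b; 0, 1] (by simp), by
        refine ⟨?_, ?_, ?_⟩ <;> simp [Matrix.GeneralLinearGroup.mkOfDetNeZero]⟩
      left_inv := ?_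
      right_inv := ?_ }
  · intro A
    obtain ⟨h1, h2, h3⟩ := A.2
    ext i j
    fin_cases i <;> fin_cases j <;>
      simp [Matrix.GeneralLinearGroup.mkOfDetNeZero, h1, h2, h3]
  · intro b
    simp [Matrix.GeneralLinearGroup.mkOfDetNeZero]

lemma card_SL2 [Fintype F] :
    Nat.card (SL2 F) = Fintype.card F * (Fintype.card F ^ 2 - 1) := by
  classical
  set q := Fintype.card F with hq
  have hq1 : 1 < q := Fintype.one_lt_card
  have hker : SL2 F = (Matrix.GeneralLinearGroup.det (n := Fin 2) (R := F)).ker := by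
    ext A
    rw [MonoidHom.mem_ker, ← Units.val_inj]
    rfl
  have hsurj : Function.Surjective (Matrix.GeneralLinearGroup.det (n := Fin 2) (R := F)) := by
    intro u
    refine ⟨Matrix.GeneralLinearGroup.mkOfDetNeZero !![u.1, 0; 0, 1] (by simp), ?_⟩
    ext
    simp [Matrix.GeneralLinearGroup.mkOfDetNeZero]
  have h1 := Subgroup.card_mul_index (SL2 F)
  have h2 : (SL2 F).index = q - 1 := by
    rw [hker, Subgroup.index_ker, MonoidHom.range_eq_top.2 hsurj, Subgroup.card_top,
      Nat.card_eq_fintype_card, Fintype.card_units]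
  rw [h2, Matrix.card_GL_field, Fin.prod_univ_two, ← hq] at h1
  simp only [Fin.val_zero, Fin.val_one, pow_zero, pow_one] at h1
  have h3 : q ^ 2 - q = q * (q - 1) := by rw [sq, Nat.mul_sub, mul_one]
  rw [h3] at h1
  refine Nat.eq_of_mul_eq_mul_right (show 0 < q - 1 by omega) (h1.trans ?_)
  ring

end pairAct

/-! ### Polynomials invariant under translations -/

section translations

variable {F R : Type} [Field F] [Fintype F] [CommRing R]

/-- The polynomial `T ^ q - a ^ (q - 1) * T`, with roots the multiples of `a` by elements
of `F`. -/
def orbitPoly (F : Type) [Fintype F] {R : Type} [CommRing R] (a : R) : Polynomial R :=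
  Polynomial.X ^ Fintype.card F - Polynomial.C (a ^ (Fintype.card F - 1)) * Polynomial.X

lemma degree_orbitPoly_aux (a : R) :
    (Polynomial.C (a ^ (Fintype.card F - 1)) * Polynomial.X).degree <
      (Fintype.card F : WithBot ℕ) :=
  (Polynomial.degree_C_mul_X_le _).trans_lt (by exact_mod_cast Fintype.one_lt_card)

lemma monic_orbitPoly [IsDomain R] (a : R) : (orbitPoly F a).Monic :=
  Polynomial.monic_X_pow_sub (degree_orbitPoly_aux a)

lemma natDegree_orbitPoly [IsDomain R] (a : R) : (orbitPoly F a).natDegree = Fintype.card F := by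
  refine Polynomial.natDegree_eq_of_degree_eq_some ?_
  unfold orbitPoly
  rw [Polynomial.degree_sub_eq_left_of_degree_lt]
  · exact Polynomial.degree_X_pow _
  · rw [Polynomial.degree_X_pow]
    exact degree_orbitPoly_aux a

variable [Algebra F R]

lemma smul_pow_card (b : F) (a : R) :
    (b • a) ^ Fintype.card F = a ^ (Fintype.card F - 1) * (b • a) := by
  rw [smul_pow, FiniteField.pow_card, mul_smul_comm, ← pow_succ,
    Nat.sub_add_cancel Fintype.card_pos]

variable [IsDomain R]

lemma prod_X_sub_C_smul_dvd {a : R} (ha : a ≠ 0) {f : Polynomial R}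
    (hf : ∀ b : F, f.eval (b • a) = 0) :
    ∏ b : F, (Polynomial.X - Polynomial.C (b • a)) ∣ f := by
  classical
  by_cases hf0 : f = 0
  · simp [hf0]
  have hinj : Function.Injective (fun b : F => b • a) := by
    intro b c h
    have h0 : (b - c) • a = 0 := by rw [sub_smul, sub_eq_zero]; exact h
    rcases smul_eq_zero.1 h0 with h | h
    · exact sub_eq_zero.1 h
    · exact absurd h ha
  have hroots : (Finset.univ.image (fun b : F => b • a)).val ≤ f.roots := by
    rw [Multiset.le_iff_subset (Finset.nodup _)]
    intro x hx
    simp only [Finset.mem_val, Finset.mem_image, Finset.mem_univ, true_and] at hx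
    obtain ⟨b, rfl⟩ := hx
    exact (Polynomial.mem_roots hf0).2 (hf b)
  have hdvd := (Multiset.prod_X_sub_C_dvd_iff_le_roots hf0 _).2 hroots
  rwa [Finset.image_val_of_injOn hinj.injOn, Multiset.map_map] at hdvd

lemma orbitPoly_eq_prod {a : R} (ha : a ≠ 0) :
    orbitPoly F a = ∏ b : F, (Polynomial.X - Polynomial.C (b • a)) := by
  refine (Polynomial.eq_of_monic_of_dvd_of_natDegree_le
    (p := ∏ b : F, (Polynomial.X - Polynomial.C (b • a)))
    (Polynomial.monic_prod_of_monic _ _ fun b _ => Polynomial.monic_X_sub_C _)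
    (monic_orbitPoly a) (prod_X_sub_C_smul_dvd ha fun b => ?_) ?_)
  · rw [orbitPoly]
    simp [smul_pow_card]
  · rw [natDegree_orbitPoly, Polynomial.natDegree_prod_of_monic _ _
      fun b _ => Polynomial.monic_X_sub_C _]
    simp

lemma orbitPoly_comp (a : R) (b : F) :
    (orbitPoly F a).comp (Polynomial.X - Polynomial.C (b • a)) = orbitPoly F a := by
  by_cases ha : a = 0
  · simp [ha]
  rw [orbitPoly_eq_prod ha, Polynomial.prod_comp]
  refine Fintype.prod_equiv (Equiv.addRight b) _ _ fun c => ?_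
  simp only [Polynomial.sub_comp, Polynomial.X_comp, Polynomial.C_comp, Equiv.coe_addRight,
    add_smul, Polynomial.C_add]
  ring

lemma exists_comp_orbitPoly {a : R} (ha : a ≠ 0) (f : Polynomial R)
    (hf : ∀ b : F, f.comp (Polynomial.X - Polynomial.C (b • a)) = f) :
    ∃ g : Polynomial R, f = g.comp (orbitPoly F a) := by
  classical
  induction hn : f.natDegree using Nat.strong_induction_on generalizing f with
  | _ n ih =>
    have hroot : ∀ b : F, (f - Polynomial.C (f.eval 0)).eval (b • a) = 0 := by
      intro b
      have := congrArg (Polynomial.eval (b • a)) (hf b)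
      rw [Polynomial.eval_comp] at this
      simp only [Polynomial.eval_sub, Polynomial.eval_X, Polynomial.eval_C, sub_self] at this ⊢
      rw [this, sub_self]
    have hdvd : orbitPoly F a ∣ f - Polynomial.C (f.eval 0) := by
      rw [orbitPoly_eq_prod ha]
      exact prod_X_sub_C_smul_dvd ha hroot
    obtain ⟨g, hg⟩ := hdvd
    by_cases hg0 : g = 0
    · refine ⟨Polynomial.C (f.eval 0), ?_⟩
      rw [hg0, mul_zero, sub_eq_zero] at hg
      rw [Polynomial.C_comp]
      exact hg
    have hfg : f = Polynomial.C (f.eval 0) + orbitPoly F a * g := by rw [← hg]; ring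
    have hginv : ∀ b : F, g.comp (Polynomial.X - Polynomial.C (b • a)) = g := by
      intro b
      have h := congrArg (fun p => p.comp (Polynomial.X - Polynomial.C (b • a))) hg
      simp only [Polynomial.sub_comp, Polynomial.mul_comp, Polynomial.C_comp] at h
      rw [hf b, orbitPoly_comp, hg] at h
      exact (mul_left_cancel₀ (monic_orbitPoly a).ne_zero h).symm
    have hdeg : g.natDegree < n := by
      have h := congrArg Polynomial.natDegree hg
      rw [Polynomial.natDegree_sub_C, (monic_orbitPoly a).natDegree_mul' hg0,
        natDegree_orbitPoly, hn] at h
      have := Fintype.card_pos (α := F)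
      omega
    obtain ⟨g', hg'⟩ := ih _ hdeg g hginv rfl
    refine ⟨Polynomial.C (f.eval 0) + Polynomial.X * g', ?_⟩
    rw [Polynomial.add_comp, Polynomial.mul_comp, Polynomial.C_comp, Polynomial.X_comp, ← hg']
    exact hfg

end translations

/-! ### Invariants of the unipotent group, up to powers of `x₁` -/

section unipotent

variable {F : Type} [Field F]

/-- A polynomial in four variables seen as a univariate polynomial in the variable `X v`. -/
def toPoly (v : Fin 4) : R2 F →ₐ[F] Polynomial (R2 F) :=
  aeval fun i => if i = v then Polynomial.X else Polynomial.C (X i)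

lemma toPoly_X_self (v : Fin 4) : toPoly v (X v : R2 F) = Polynomial.X := by simp [toPoly]

lemma toPoly_X_of_ne {v i : Fin 4} (h : i ≠ v) :
    toPoly v (X i : R2 F) = Polynomial.C (X i) := by simp [toPoly, h]

lemma toPoly_C (v : Fin 4) (c : F) : toPoly v (C c : R2 F) = Polynomial.C (C c) := by
  simp [toPoly]

lemma eval_toPoly (v : Fin 4) (f : R2 F) : (toPoly v f).eval (X v) = f := by
  induction f using MvPolynomial.induction_on with
  | C c => rw [toPoly_C, Polynomial.eval_C]
  | add p q hp hq => rw [map_add, Polynomial.eval_add, hp, hq]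
  | mul_X p i hp =>
    rw [map_mul, Polynomial.eval_mul, hp]
    by_cases h : i = v
    · subst h
      rw [toPoly_X_self, Polynomial.eval_X]
    · rw [toPoly_X_of_ne h, Polynomial.eval_C]

lemma toPoly_injective (v : Fin 4) : Function.Injective (toPoly v : R2 F → _) :=
  Function.LeftInverse.injective (eval_toPoly v)

/-- If an endomorphism `τ` fixes the variables other than `X v`, then it acts on univariate
polynomials in `X v` as a composition. -/
lemma toPoly_apply_eq_comp {v : Fin 4} {τ : R2 F →ₐ[F] R2 F}
    (h : ∀ i, i ≠ v → τ (X i) = X i) (f : R2 F) :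
    toPoly v (τ f) = (toPoly v f).comp (toPoly v (τ (X v))) := by
  induction f using MvPolynomial.induction_on with
  | C c =>
    rw [← algebraMap_eq, AlgHom.commutes, algebraMap_eq, toPoly_C, Polynomial.C_comp]
  | add p q hp hq => rw [map_add, map_add, hp, hq, map_add, Polynomial.add_comp]
  | mul_X p i hp =>
    rw [map_mul, map_mul, hp, map_mul, Polynomial.mul_comp]
    by_cases hi : i = v
    · subst hi
      rw [toPoly_X_self, Polynomial.X_comp]
    · rw [h i hi, toPoly_X_of_ne hi, Polynomial.C_comp]

lemma map_toPoly {v : Fin 4} {ρ : R2 F →ₐ[F] R2 F} (h : ∀ i, i ≠ v → ρ (X i) = X i) (f : R2 F) :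
    (toPoly v f).map (ρ : R2 F →+* R2 F) = toPoly v f := by
  induction f using MvPolynomial.induction_on with
  | C c =>
    rw [toPoly_C, Polynomial.map_C, RingHom.coe_coe, ← algebraMap_eq, AlgHom.commutes]
  | add p q hp hq => rw [map_add, Polynomial.map_add, hp, hq]
  | mul_X p i hp =>
    rw [map_mul, Polynomial.map_mul, hp]
    by_cases hi : i = v
    · subst hi
      rw [toPoly_X_self, Polynomial.map_X]
    · rw [toPoly_X_of_ne hi, Polynomial.map_C, RingHom.coe_coe, h i hi]

lemma eval_orbitPoly_X0 [Fintype F] :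
    (orbitPoly F (X 0 : R2 F)).eval (X 1) = phi2 F (Fintype.card F) := by
  simp [orbitPoly, phi2, mul_comm]

lemma mem_range_of_translation [Fintype F] {f : R2 F}
    (hf : ∀ b : F, aeval ![X 0, X 1 - C b * X 0, X 2, X 3] f = f) :
    ∃ g : R2 F, f = aeval ![X 0, phi2 F (Fintype.card F), X 2, X 3] g := by
  obtain ⟨g, hg⟩ := exists_comp_orbitPoly (F := F) (a := (X 0 : R2 F)) (X_ne_zero 0)
    (toPoly 1 f) fun b => by
      have h := toPoly_apply_eq_comp (v := 1)
        (τ := (aeval ![X 0, X 1 - C b * X 0, X 2, X 3] : R2 F →ₐ[F] R2 F))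
        (by intro i hi; fin_cases i <;> simp at hi ⊢) f
      rw [hf b] at h
      rw [aeval_X] at h
      simp only [Matrix.cons_val_one, Matrix.cons_val_zero, map_sub, map_mul, toPoly_C] at h
      rw [toPoly_X_self, toPoly_X_of_ne (by decide), ← Polynomial.C_mul, ← smul_eq_C_mul] at h
      exact h.symm
  set ρ : R2 F →ₐ[F] R2 F := aeval ![X 0, 0, X 2, X 3] with hρdef
  have hρ : ∀ i, i ≠ 1 → ρ (X i) = X i := by
    intro i hi
    fin_cases i <;> simp [ρ] at hi ⊢
  have h1 := map_toPoly hρ f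
  have h2 : (orbitPoly F (X 0 : R2 F)).map (ρ : R2 F →+* R2 F) = orbitPoly F (X 0) := by
    simp [orbitPoly, ρ]
  rw [hg, Polynomial.map_comp, h2, ← hg] at h1
  have h3 := eval_toPoly 1 f
  rw [← h1, Polynomial.eval_comp, eval_orbitPoly_X0] at h3
  refine ⟨(g.map (ρ : R2 F →+* R2 F)).eval (X 1), ?_⟩
  have h4 : ∀ c : R2 F, aeval ![X 0, phi2 F (Fintype.card F), X 2, X 3] (ρ c) = ρ c := by
    intro c
    rw [← AlgHom.comp_apply]
    congr 1
    ext1 i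
    fin_cases i <;> simp [ρ]
  rw [← h3, Polynomial.eval_eq_sum_range, Polynomial.eval_eq_sum_range, map_sum]
  refine Finset.sum_congr rfl fun i _ => ?_
  rw [map_mul, map_pow, aeval_X, Polynomial.coeff_map, RingHom.coe_coe, h4]
  rfl

/-- The action of the unipotent matrix with parameter `b`. -/
def unipotentAct (b : F) : R2 F →ₐ[F] R2 F :=
  aeval ![X 0, X 1 - C b * X 0, X 2 + C b * X 3, X 3]

lemma unipotentAct_of_mem {f : R2 F} (hf : f ∈ invariantRing (P2 F)) (b : F) :
    unipotentAct b f = f := by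
  have h := (mem_invariantRing_iff P2_le_SL2 f).1 hf
    (Matrix.GeneralLinearGroup.mkOfDetNeZero !![1, b; 0, 1] (by simp)) (by
        refine ⟨?_, ?_, ?_⟩ <;> simp [Matrix.GeneralLinearGroup.mkOfDetNeZero])
  refine Eq.trans ?_ h
  congr 1
  ext1 i
  fin_cases i <;> simp [pairAct, unipotentAct, Matrix.GeneralLinearGroup.mkOfDetNeZero]

/-- The substitution `y₁ ↦ u₀`. -/
def substU (F : Type) [Field F] : R2 F →ₐ[F] R2 F := aeval ![X 0, X 1, u0 F, X 3]

lemma substU_injective : Function.Injective (substU F) := by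
  obtain ⟨ι, hι⟩ : ∃ ι : R2 F →ₐ[F] FractionRing (R2 F), Function.Injective ι :=
    ⟨IsScalarTower.toAlgHom F (R2 F) _, IsFractionRing.injective (R2 F) _⟩
  let χ : R2 F →ₐ[F] FractionRing (R2 F) :=
    aeval ![ι (X 0), ι (X 1), (ι (X 2) - ι (X 1) * ι (X 3)) / ι (X 0), ι (X 3)]
  have h0 : ι (X 0) ≠ 0 := by
    rw [Ne, map_eq_zero_iff ι hι]
    exact X_ne_zero 0
  have h : χ.comp (substU F) = ι := by
    ext1 i
    fin_cases i <;> simp [χ, substU, u0]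
    field_simp
    ring
  refine Function.Injective.of_comp (f := χ) ?_
  rw [← AlgHom.coe_comp, h]
  exact hι

lemma exists_pow_mul_eq_substU (f : R2 F) : ∃ n p, X 0 ^ n * f = substU F p := by
  induction f using MvPolynomial.induction_on with
  | C c => exact ⟨0, C c, by simp [substU]⟩
  | add p q hp hq =>
    obtain ⟨n, p', hp⟩ := hp
    obtain ⟨m, q', hq⟩ := hq
    refine ⟨n + m, X 0 ^ m * p' + X 0 ^ n * q', ?_⟩
    rw [map_add, map_mul, map_mul, ← hp, ← hq]
    simp [substU]
    ring
  | mul_X p i hp =>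
    obtain ⟨n, p', hp⟩ := hp
    have : ∃ r, X 0 * X i = substU F r := by
      fin_cases i
      · exact ⟨X 0 * X 0, by simp [substU]⟩
      · exact ⟨X 0 * X 1, by simp [substU]⟩
      · exact ⟨X 2 - X 1 * X 3, by simp [substU, u0]⟩
      · exact ⟨X 0 * X 3, by simp [substU]⟩
    obtain ⟨r, hr⟩ := this
    refine ⟨n + 1, p' * r, ?_⟩
    rw [map_mul, ← hp, ← hr]
    ring

lemma exists_pow_mul_eq_of_invariant [Fintype F] {f : R2 F} (hf : f ∈ invariantRing (P2 F)) :
    ∃ (n : ℕ) (g : R2 F), X 0 ^ n * f = aeval ![X 0, phi2 F (Fintype.card F), u0 F, X 3] g := by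
  obtain ⟨n, p, hp⟩ := exists_pow_mul_eq_substU f
  have hcomm : ∀ b : F, (unipotentAct b).comp (substU F) =
      (substU F).comp (aeval ![X 0, X 1 - C b * X 0, X 2, X 3]) := by
    intro b
    ext1 i
    fin_cases i <;> simp [substU, unipotentAct, u0]
    ring
  obtain ⟨g, hg⟩ := mem_range_of_translation (f := p) fun b => by
    apply substU_injective
    rw [← AlgHom.comp_apply, ← hcomm, AlgHom.comp_apply, ← hp, map_mul, map_pow,
      unipotentAct_of_mem hf]
    simp [unipotentAct]
  refine ⟨n, g, ?_⟩
  rw [hp, hg, ← AlgHom.comp_apply]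
  congr 1
  ext1 i
  fin_cases i <;> simp [substU, phi2]

end unipotent

/-! ### Modules generated by powers -/

section powers

variable {F R : Type} [Field F] [CommRing R] [Algebra F R] {A : Subalgebra F R}

/-- The submodule spanned by `1, u, …, u ^ (n - 1)`. -/
def powersBelow (A : Subalgebra F R) (u : R) (n : ℕ) : Submodule A R :=
  Submodule.span A ((fun k => u ^ k) '' (Finset.range n : Set ℕ))

lemma pow_mem_powersBelow {u : R} {n k : ℕ} (hk : k < n) : u ^ k ∈ powersBelow A u n :=
  Submodule.subset_span ⟨k, by simpa using hk, rfl⟩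

lemma mul_mem_mul_of_left {Q P : Submodule A R} {g : R} (hg : ∀ x ∈ Q, g * x ∈ Q) :
    ∀ x ∈ Q * P, g * x ∈ Q * P := by
  intro x hx
  induction hx using Submodule.mul_induction_on' with
  | mem_mul_mem m hm n hn =>
    rw [← mul_assoc]
    exact Submodule.mul_mem_mul (hg m hm) hn
  | add x _ y _ hx hy => rw [mul_add]; exact add_mem hx hy

lemma mul_mem_mul_powersBelow {Q : Submodule A R} {p r u : R} {n : ℕ} (hn : 2 ≤ n)
    (hp : ∀ x ∈ Q, p * x ∈ Q) (hr : ∀ x ∈ Q, r * x ∈ Q) (hu : u ^ n = p + r * u) :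
    ∀ x ∈ Q * powersBelow A u n, u * x ∈ Q * powersBelow A u n := by
  intro x hx
  induction hx using Submodule.mul_induction_on' with
  | mem_mul_mem m hm s hs =>
    unfold powersBelow at hs
    induction hs using Submodule.span_induction with
    | mem x hx =>
      obtain ⟨k, hk, rfl⟩ := hx
      simp only [Finset.coe_range, Set.mem_Iio] at hk
      by_cases hkn : k + 1 < n
      · have h : u * (m * u ^ k) = m * u ^ (k + 1) := by ring
        exact h ▸ Submodule.mul_mem_mul hm (pow_mem_powersBelow hkn)
      · have hkn' : n = k + 1 := by omega
        have h : u * (m * u ^ k) = p * m * u ^ 0 + r * m * u ^ 1 := by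
          have : u * (m * u ^ k) = m * u ^ n := by rw [hkn']; ring
          rw [this, hu]
          ring
        exact h ▸ add_mem (Submodule.mul_mem_mul (hp m hm) (pow_mem_powersBelow (by omega)))
          (Submodule.mul_mem_mul (hr m hm) (pow_mem_powersBelow (by omega)))
    | zero => simp
    | add x y _ _ hx hy => rw [mul_add, mul_add]; exact add_mem hx hy
    | smul c x _ hx =>
      rw [mul_smul_comm, mul_smul_comm]
      exact Submodule.smul_mem _ c hx
  | add x _ y _ hx hy => rw [mul_add]; exact add_mem hx hy

lemma one_mem_mul_powersBelow {Q : Submodule A R} (hQ : 1 ∈ Q) {u : R} {n : ℕ} (hn : 0 < n) :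
    1 ∈ Q * powersBelow A u n := by
  have h := Submodule.mul_mem_mul hQ (pow_mem_powersBelow (A := A) (u := u) hn)
  rwa [pow_zero, mul_one] at h

/-- The subalgebra of the elements which stabilize a submodule. -/
def multipliers (Q : Submodule A R) : Subalgebra F R where
  carrier := {g | ∀ x ∈ Q, g * x ∈ Q}
  mul_mem' := fun {f g} hf hg x hx => by rw [mul_assoc]; exact hf _ (hg x hx)
  add_mem' := fun {f g} hf hg x hx => by rw [add_mul]; exact add_mem (hf x hx) (hg x hx)
  algebraMap_mem' := fun c x hx => by
    have : algebraMap F R c * x = algebraMap F A c • x := by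
      rw [Subalgebra.smul_def, smul_eq_mul]; rfl
    exact this ▸ Submodule.smul_mem _ _ hx

lemma mem_of_mem_adjoin {Q : Submodule A R} {s : Set R} (hQ : 1 ∈ Q)
    (hs : s ⊆ multipliers Q) {f : R} (hf : f ∈ Algebra.adjoin F s) : f ∈ Q := by
  have h : f ∈ multipliers Q := Algebra.adjoin_le hs hf
  simpa using h 1 hQ

lemma exists_sum_of_mem_powersBelow {u f : R} {n : ℕ} (hf : f ∈ powersBelow A u n) :
    ∃ c : ℕ → A, f = ∑ k ∈ Finset.range n, (c k : R) * u ^ k := by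
  obtain ⟨c, hc⟩ := Submodule.mem_span_image_finset_iff_exists_fun A |>.1 hf
  refine ⟨fun k => if h : k ∈ Finset.range n then c ⟨k, h⟩ else 0, hc.symm.trans ?_⟩
  rw [← Finset.sum_coe_sort (Finset.range n)]
  refine Finset.sum_congr rfl fun k _ => ?_
  beta_reduce
  rw [dif_pos k.2]
  rfl

end powers

/-! ### The invariants of the unipotent group -/

section unipotent

variable {F : Type} [Field F]

lemma add_pow_card [Fintype F] {R : Type} [CommRing R] [Algebra F R] (a b : R) :
    (a + b) ^ Fintype.card F = a ^ Fintype.card F + b ^ Fintype.card F := by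
  exact map_add (FiniteField.frobeniusAlgHom F R) a b

/-- The evaluation at `x₁ = 0`. -/
def evalX0 (F : Type) [Field F] : R2 F →ₐ[F] R2 F := aeval ![0, X 1, X 2, X 3]

lemma X0_dvd_of_evalX0 {f : R2 F} (hf : evalX0 F f = 0) : X 0 ∣ f := by
  have h : ∀ f : R2 F, X 0 ∣ f - evalX0 F f := by
    intro f
    induction f using MvPolynomial.induction_on with
    | C c => simp [evalX0]
    | add p q hp hq => rw [map_add, add_sub_add_comm]; exact dvd_add hp hq
    | mul_X p i hp =>
      have hi : X 0 ∣ X i - evalX0 F (X i) := by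
        fin_cases i <;> simp [evalX0]
      have h : p * X i - evalX0 F (p * X i) =
          (p - evalX0 F p) * X i + evalX0 F p * (X i - evalX0 F (X i)) := by
        rw [map_mul]; ring
      rw [h]
      exact dvd_add (hp.mul_right _) (hi.mul_left _)
  have := h f
  rwa [hf, sub_zero] at this

variable [Fintype F]

lemma u0_pow_card : (u0 F) ^ Fintype.card F =
    (X 0 ^ Fintype.card F * phi2s F (Fintype.card F) +
      X 3 ^ Fintype.card F * phi2 F (Fintype.card F)) +
      (X 0 * X 3) ^ (Fintype.card F - 1) * u0 F := by
  unfold u0 phi2 phi2s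
  rw [add_pow_card]
  obtain ⟨m, hm⟩ : ∃ m, Fintype.card F = m + 1 := ⟨_, (Nat.sub_add_cancel Fintype.card_pos).symm⟩
  rw [hm, Nat.add_sub_cancel]
  ring

/-- The subalgebra generated by `x₁, φ₂, φ₂*, y₂`. -/
def unipotentBase (F : Type) [Field F] [Fintype F] : Subalgebra F (R2 F) :=
  (aeval ![X 0, phi2 F (Fintype.card F), phi2s F (Fintype.card F), X 3] :
    R2 F →ₐ[F] R2 F).range

/-- The generators of the algebra of invariants of the unipotent group. -/
def unipotentGens (F : Type) [Field F] [Fintype F] : Set (R2 F) :=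
  {X 0, phi2 F (Fintype.card F), phi2s F (Fintype.card F), X 3, u0 F}

lemma X0_mem_unipotentBase : X 0 ∈ unipotentBase F := ⟨X 0, by simp⟩
lemma phi2_mem_unipotentBase : phi2 F (Fintype.card F) ∈ unipotentBase F := ⟨X 1, by simp⟩
lemma phi2s_mem_unipotentBase : phi2s F (Fintype.card F) ∈ unipotentBase F := ⟨X 2, by simp⟩
lemma X3_mem_unipotentBase : X 3 ∈ unipotentBase F := ⟨X 3, by simp⟩

lemma unipotentBase_le : unipotentBase F ≤ Algebra.adjoin F (unipotentGens F) := by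
  unfold unipotentBase
  rw [← Algebra.adjoin_range_eq_range_aeval]
  refine Algebra.adjoin_mono ?_
  rintro _ ⟨i, rfl⟩
  fin_cases i <;> simp [unipotentGens]

lemma mem_powersBelow_of_mem_adjoin {f : R2 F} (hf : f ∈ Algebra.adjoin F (unipotentGens F)) :
    f ∈ powersBelow (unipotentBase F) (u0 F) (Fintype.card F) := by
  have hbase : ∀ g ∈ unipotentBase F, ∀ x ∈ (1 : Submodule (unipotentBase F) (R2 F)),
      g * x ∈ (1 : Submodule (unipotentBase F) (R2 F)) := by
    intro g hg x hx
    exact Submodule.smul_mem _ (⟨g, hg⟩ : unipotentBase F) hx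
  have hu := mul_mem_mul_powersBelow (A := unipotentBase F) Fintype.one_lt_card
    (hbase _ (add_mem (mul_mem (pow_mem X0_mem_unipotentBase _) phi2s_mem_unipotentBase)
      (mul_mem (pow_mem X3_mem_unipotentBase _) phi2_mem_unipotentBase)))
    (hbase _ (pow_mem (mul_mem X0_mem_unipotentBase X3_mem_unipotentBase) _)) (u0_pow_card (F := F))
  rw [← one_mul (powersBelow _ _ _)]
  refine mem_of_mem_adjoin (one_mem_mul_powersBelow (Submodule.mem_one.2 ⟨1, map_one _⟩) Fintype.card_pos) ?_ hf
  intro g hg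
  simp only [unipotentGens, Set.mem_insert_iff, Set.mem_singleton_iff] at hg
  rcases hg with rfl | rfl | rfl | rfl | rfl
  · exact mul_mem_mul_of_left (hbase _ X0_mem_unipotentBase)
  · exact mul_mem_mul_of_left (hbase _ phi2_mem_unipotentBase)
  · exact mul_mem_mul_of_left (hbase _ phi2s_mem_unipotentBase)
  · exact mul_mem_mul_of_left (hbase _ X3_mem_unipotentBase)
  · exact hu

lemma substPhi_injective : Function.Injective
    (aeval ![X 0, X 1, phi2s F (Fintype.card F), X 3] : R2 F →ₐ[F] R2 F) := by
  rw [injective_iff_map_eq_zero]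
  intro f hf
  have h := toPoly_apply_eq_comp (v := 2)
    (τ := (aeval ![X 0, X 1, phi2s F (Fintype.card F), X 3] : R2 F →ₐ[F] R2 F))
    (by intro i hi; fin_cases i <;> simp at hi ⊢) f
  have h2 : toPoly 2 (phi2s F (Fintype.card F)) = orbitPoly F (X 3) := by
    rw [phi2s, orbitPoly, map_sub, map_mul, map_pow, map_pow, toPoly_X_self,
      toPoly_X_of_ne (by decide), Polynomial.C_pow, mul_comm]
  rw [hf, map_zero, aeval_X] at h
  simp only [Matrix.cons_val] at h
  rw [h2] at h
  rcases Polynomial.comp_eq_zero_iff.1 h.symm with h | h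
  · exact (map_eq_zero_iff _ (toPoly_injective 2)).1 h
  · have := natDegree_orbitPoly (F := F) (X 3 : R2 F)
    rw [h.2, Polynomial.natDegree_C] at this
    exact absurd this.symm Fintype.card_ne_zero

lemma toPoly_subst_eq_expand (f : R2 F) :
    toPoly 1 (aeval ![X 0, X 1 ^ Fintype.card F, phi2s F (Fintype.card F), X 3] f : R2 F) =
      Polynomial.expand (R2 F) (Fintype.card F)
        (toPoly 1 (aeval ![X 0, X 1, phi2s F (Fintype.card F), X 3] f : R2 F)) := by
  have h2 : toPoly 1 (phi2s F (Fintype.card F)) = Polynomial.C (phi2s F (Fintype.card F)) := by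
    rw [phi2s, map_sub, map_mul, map_pow, map_pow, toPoly_X_of_ne (by decide),
      toPoly_X_of_ne (by decide)]
    simp
  have hi : ∀ i : Fin 4, toPoly 1 (aeval ![X 0, X 1 ^ Fintype.card F,
      phi2s F (Fintype.card F), X 3] (X i : R2 F) : R2 F) =
      Polynomial.expand (R2 F) (Fintype.card F)
        (toPoly 1 (aeval ![X 0, X 1, phi2s F (Fintype.card F), X 3] (X i : R2 F) : R2 F)) := by
    intro i
    rw [aeval_X, aeval_X]
    fin_cases i
    · simp only [Fin.zero_eta, Matrix.cons_val]
      rw [toPoly_X_of_ne (by decide), Polynomial.expand_C]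
    · simp only [Fin.mk_one, Matrix.cons_val]
      rw [map_pow, toPoly_X_self, Polynomial.expand_X]
    · simp only [Fin.reduceFinMk, Matrix.cons_val]
      rw [h2, Polynomial.expand_C]
    · simp only [Fin.reduceFinMk, Matrix.cons_val]
      rw [toPoly_X_of_ne (by decide), Polynomial.expand_C]
  induction f using MvPolynomial.induction_on with
  | C c => simp
  | add p q hp hq => simp only [map_add, hp, hq]
  | mul_X p i hp => rw [map_mul, map_mul, map_mul, map_mul, map_mul, hp, hi]

lemma evalX0_subst (g : R2 F) :
    evalX0 F (aeval ![X 0, phi2 F (Fintype.card F), phi2s F (Fintype.card F), X 3] g) =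
      aeval ![X 0, X 1 ^ Fintype.card F, phi2s F (Fintype.card F), X 3] (evalX0 F g) := by
  have h : ((evalX0 F).comp
      (aeval ![X 0, phi2 F (Fintype.card F), phi2s F (Fintype.card F), X 3]) : R2 F →ₐ[F] R2 F) =
      (aeval ![X 0, X 1 ^ Fintype.card F, phi2s F (Fintype.card F), X 3]).comp (evalX0 F) := by
    have := Fintype.one_lt_card (α := F)
    ext1 i
    fin_cases i <;> simp [evalX0, phi2, phi2s]
    omega
  exact DFunLike.congr_fun h g

lemma mem_adjoin_of_X0_mul_mem {f : R2 F} (hf : X 0 * f ∈ Algebra.adjoin F (unipotentGens F)) :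
    f ∈ Algebra.adjoin F (unipotentGens F) := by
  obtain ⟨c, hc⟩ := exists_sum_of_mem_powersBelow (mem_powersBelow_of_mem_adjoin hf)
  choose r hr using fun k => (c k).2
  simp only [AlgHom.toRingHom_eq_coe, RingHom.coe_coe] at hr
  have hsum := congrArg (fun f => toPoly 1 (evalX0 F f)) hc
  simp only [map_mul, map_sum, map_pow, ← hr, evalX0_subst, toPoly_subst_eq_expand] at hsum
  have hu : toPoly 1 (evalX0 F (u0 F)) = Polynomial.C (X 3) * Polynomial.X := by
    have h : evalX0 F (u0 F) = X 3 * X 1 := by simp [evalX0, u0, mul_comm]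
    rw [h, map_mul, toPoly_X_self, toPoly_X_of_ne (by decide)]
  have hX : evalX0 F (X 0) = 0 := by simp [evalX0]
  rw [hX, map_zero, zero_mul, hu] at hsum
  have hzero : ∀ k < Fintype.card F, evalX0 F (r k) = 0 := by
    intro k hk
    rw [← map_eq_zero_iff _ (substPhi_injective (F := F)),
      ← map_eq_zero_iff _ (toPoly_injective 1)]
    ext1 e
    have he := congrArg (fun p => Polynomial.coeff p (e * Fintype.card F + k)) hsum
    simp only [Polynomial.coeff_zero, Polynomial.finsetSum_coeff, mul_pow, ← Polynomial.C_pow] at he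
    rw [Finset.sum_eq_single_of_mem k (Finset.mem_range.2 hk)] at he
    · rw [mul_left_comm, Polynomial.coeff_C_mul, Polynomial.coeff_mul_X_pow,
        Polynomial.coeff_expand_mul Fintype.card_pos] at he
      rw [Polynomial.coeff_zero]
      exact (mul_eq_zero.1 he.symm).resolve_left (pow_ne_zero _ (X_ne_zero 3))
    · intro l hl hlk
      have hl := Finset.mem_range.1 hl
      rw [mul_left_comm, Polynomial.coeff_C_mul, Polynomial.coeff_mul_X_pow',
        Polynomial.coeff_expand Fintype.card_pos]
      split_ifs with h1 h2
      · obtain ⟨d, hd⟩ := h2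
        have h3 : (e * Fintype.card F + k) % Fintype.card F =
            (l + Fintype.card F * d) % Fintype.card F := by
          rw [← hd]
          congr 1
          omega
        rw [mul_comm e, Nat.mul_add_mod, Nat.add_mul_mod_self_left, Nat.mod_eq_of_lt hk,
          Nat.mod_eq_of_lt hl] at h3
        exact absurd h3.symm hlk
      · exact mul_zero _
      · exact mul_zero _
  have hdvd : ∀ k, ∃ s, k < Fintype.card F → r k = X 0 * s := by
    intro k
    by_cases hk : k < Fintype.card F
    · obtain ⟨s, hs⟩ := X0_dvd_of_evalX0 (hzero k hk)
      exact ⟨s, fun _ => hs⟩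
    · exact ⟨0, fun h => absurd h hk⟩
  choose s hs using hdvd
  have hfs : f = ∑ k ∈ Finset.range (Fintype.card F),
      aeval ![X 0, phi2 F (Fintype.card F), phi2s F (Fintype.card F), X 3] (s k) * u0 F ^ k := by
    refine mul_left_cancel₀ (X_ne_zero (R := F) (0 : Fin 4)) ?_
    rw [hc, Finset.mul_sum]
    refine Finset.sum_congr rfl fun k hk => ?_
    rw [← hr k, hs k (Finset.mem_range.1 hk), map_mul, aeval_X]
    simp [mul_assoc]
  rw [hfs]
  refine sum_mem fun k _ => mul_mem (unipotentBase_le ⟨s k, rfl⟩)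
    (pow_mem (Algebra.subset_adjoin ?_) _)
  simp [unipotentGens]

lemma mem_adjoin_of_mem_invariantRing {f : R2 F} (hf : f ∈ invariantRing (P2 F)) :
    f ∈ Algebra.adjoin F (unipotentGens F) := by
  obtain ⟨n, g, hg⟩ := exists_pow_mul_eq_of_invariant hf
  have hle : ∀ g : R2 F, aeval ![X 0, phi2 F (Fintype.card F), u0 F, X 3] g ∈
      Algebra.adjoin F (unipotentGens F) := by
    intro g
    have h : g ∈ Algebra.adjoin F (Set.range X) := by rw [adjoin_range_X]; trivial
    have h1 : (aeval ![X 0, phi2 F (Fintype.card F), u0 F, X 3] : R2 F →ₐ[F] R2 F).range ≤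
        Algebra.adjoin F (unipotentGens F) := by
      rw [← Algebra.adjoin_range_eq_range_aeval]
      refine Algebra.adjoin_mono ?_
      rintro _ ⟨i, rfl⟩
      fin_cases i <;> simp [unipotentGens]
    exact h1 ⟨g, rfl⟩
  have hmem := hle g
  rw [← hg] at hmem
  clear hg hf
  induction n with
  | zero => simpa using hmem
  | succ n ih =>
    refine ih (mem_adjoin_of_X0_mul_mem ?_)
    rwa [← mul_assoc, ← pow_succ']

end unipotent

/-! ### Counting module generators -/

section spanning

variable {F R : Type} [Field F] [CommRing R] [Algebra F R] {A : Subalgebra F R}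

lemma exists_card_le_powersBelow (u : R) (n : ℕ) :
    ∃ S : Finset R, S.card ≤ n ∧ Submodule.span A (S : Set R) = powersBelow A u n := by
  classical
  refine ⟨(Finset.range n).image fun k => u ^ k, ?_, ?_⟩
  · simpa using Finset.card_image_le (s := Finset.range n) (f := fun k => u ^ k)
  · rw [Finset.coe_image]
    rfl

lemma exists_card_le_mul {P Q : Submodule A R} {m n : ℕ}
    (hP : ∃ S : Finset R, S.card ≤ m ∧ Submodule.span A (S : Set R) = P)
    (hQ : ∃ S : Finset R, S.card ≤ n ∧ Submodule.span A (S : Set R) = Q) :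
    ∃ S : Finset R, S.card ≤ m * n ∧ Submodule.span A (S : Set R) = P * Q := by
  classical
  obtain ⟨S, hS, rfl⟩ := hP
  obtain ⟨T, hT, rfl⟩ := hQ
  open scoped Pointwise in
  refine ⟨S * T, Finset.card_mul_le.trans (Nat.mul_le_mul hS hT), ?_⟩
  rw [Finset.coe_mul, Submodule.span_mul_span]

lemma multipliers_le_mul_left (P Q : Submodule A R) : multipliers P ≤ multipliers (P * Q) :=
  fun _ hg => mul_mem_mul_of_left hg

lemma multipliers_le_mul_right (P Q : Submodule A R) : multipliers Q ≤ multipliers (P * Q) :=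
  fun g hg => by
    rw [mul_comm P Q]
    exact multipliers_le_mul_left Q P hg

lemma mul_mem_of_mem {Q : Submodule A R} {c x : R} (hc : c ∈ A) (hx : x ∈ Q) : c * x ∈ Q :=
  Q.smul_mem (⟨c, hc⟩ : A) hx

lemma mem_multipliers_of_span {s : Set R} {g : R}
    (h : ∀ x ∈ s, g * x ∈ Submodule.span A s) : g ∈ multipliers (Submodule.span A s) := by
  intro x hx
  induction hx using Submodule.span_induction with
  | mem x hx => exact h x hx
  | zero => rw [mul_zero]; exact zero_mem _
  | add x y _ _ hx hy => rw [mul_add]; exact add_mem hx hy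
  | smul c x _ hx => rw [mul_smul_comm]; exact Submodule.smul_mem _ c hx

/-- Generators of the algebra `A[a, b]` as an `A`-module when `a * b` and
`b ^ (q - 1) + a ^ (q * (q - 1))` belong to `A`. -/
def pairSpan (A : Subalgebra F R) (a b : R) (q : ℕ) : Submodule A R :=
  Submodule.span A ((fun i => a ^ i) '' (Finset.range (q * (q - 1) + 1) : Set ℕ) ∪
    (fun j => b ^ (j + 1)) '' (Finset.range (q - 2) : Set ℕ))

lemma exists_card_le_pairSpan (a b : R) {q : ℕ} (hq : 2 ≤ q) :
    ∃ S : Finset R, S.card ≤ q ^ 2 - 1 ∧ Submodule.span A (S : Set R) = pairSpan A a b q := by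
  classical
  refine ⟨(Finset.range (q * (q - 1) + 1)).image (fun i => a ^ i) ∪
    (Finset.range (q - 2)).image (fun j => b ^ (j + 1)), ?_, ?_⟩
  · refine (Finset.card_union_le _ _).trans ((add_le_add Finset.card_image_le
      Finset.card_image_le).trans ?_)
    obtain ⟨m, rfl⟩ := Nat.exists_eq_add_of_le hq
    rw [Finset.card_range, Finset.card_range]
    refine Nat.le_sub_of_add_le ?_
    have h1 : 2 + m - 1 = m + 1 := by omega
    have h2 : 2 + m - 2 = m := by omega
    rw [h1, h2]
    nlinarith
  · rw [Finset.coe_union, Finset.coe_image, Finset.coe_image]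
    rfl

lemma pow_left_mem_pairSpan {a b : R} {q i : ℕ} (hi : i ≤ q * (q - 1)) :
    a ^ i ∈ pairSpan A a b q :=
  Submodule.subset_span (Or.inl ⟨i, by simpa [Nat.lt_succ_iff] using hi, rfl⟩)

lemma one_mem_pairSpan (a b : R) (q : ℕ) : 1 ∈ pairSpan A a b q := by
  simpa using pow_left_mem_pairSpan (A := A) (a := a) (b := b) (q := q) (Nat.zero_le _)

lemma pow_right_mem_pairSpan {a b : R} {q j : ℕ}
    (h : b ^ (q - 1) + a ^ (q * (q - 1)) ∈ A) (hj : j ≤ q - 1) :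
    b ^ j ∈ pairSpan A a b q := by
  rcases Nat.eq_zero_or_pos j with rfl | hj0
  · rw [pow_zero]
    exact one_mem_pairSpan a b q
  rcases hj.eq_or_lt with rfl | hj1
  · have h1 : b ^ (q - 1) = (b ^ (q - 1) + a ^ (q * (q - 1))) * 1 - a ^ (q * (q - 1)) := by ring
    rw [h1]
    exact sub_mem (mul_mem_of_mem h (one_mem_pairSpan a b q)) (pow_left_mem_pairSpan le_rfl)
  · refine Submodule.subset_span (Or.inr ⟨j - 1, ?_, ?_⟩)
    · simp only [Finset.coe_range, Set.mem_Iio]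
      omega
    · simp only [Nat.sub_add_cancel hj0]

lemma left_mem_multipliers_pairSpan {a b : R} {q : ℕ} (hq : 2 ≤ q) (hab : a * b ∈ A)
    (h : b ^ (q - 1) + a ^ (q * (q - 1)) ∈ A) : a ∈ multipliers (pairSpan A a b q) := by
  refine mem_multipliers_of_span ?_
  rintro _ (⟨i, hi, rfl⟩ | ⟨j, hj, rfl⟩)
  · simp only [Finset.coe_range, Set.mem_Iio, Nat.lt_succ_iff] at hi
    rcases hi.eq_or_lt with rfl | hi
    · have h1 : a * a ^ (q * (q - 1)) =
          (b ^ (q - 1) + a ^ (q * (q - 1))) * a ^ 1 - (a * b) * b ^ (q - 2) := by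
        obtain ⟨m, rfl⟩ := Nat.exists_eq_add_of_le hq
        rw [show 2 + m - 1 = m + 1 by omega, show 2 + m - 2 = m by omega]
        ring
      have hq1 : 1 ≤ q * (q - 1) := Nat.mul_pos (by omega) (by omega)
      beta_reduce
      rw [h1]
      exact sub_mem (mul_mem_of_mem h (pow_left_mem_pairSpan hq1))
        (mul_mem_of_mem hab (pow_right_mem_pairSpan h (by omega)))
    · beta_reduce
      rw [← pow_succ']
      exact pow_left_mem_pairSpan hi
  · simp only [Finset.coe_range, Set.mem_Iio] at hj
    have h1 : a * b ^ (j + 1) = (a * b) * b ^ j := by ring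
    beta_reduce
    rw [h1]
    exact mul_mem_of_mem hab (pow_right_mem_pairSpan h (by omega))

lemma right_mem_multipliers_pairSpan {a b : R} {q : ℕ} (hq : 2 ≤ q) (hab : a * b ∈ A)
    (h : b ^ (q - 1) + a ^ (q * (q - 1)) ∈ A) : b ∈ multipliers (pairSpan A a b q) := by
  refine mem_multipliers_of_span ?_
  rintro _ (⟨i, hi, rfl⟩ | ⟨j, hj, rfl⟩)
  · simp only [Finset.coe_range, Set.mem_Iio, Nat.lt_succ_iff] at hi
    rcases i with _ | i
    · have h1 : b * a ^ 0 = b ^ 1 := by ring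
      beta_reduce
      rw [h1]
      exact pow_right_mem_pairSpan h (by omega)
    · have h1 : b * a ^ (i + 1) = (a * b) * a ^ i := by ring
      beta_reduce
      rw [h1]
      exact mul_mem_of_mem hab (pow_left_mem_pairSpan (by omega))
  · simp only [Finset.coe_range, Set.mem_Iio] at hj
    beta_reduce
    rw [← pow_succ']
    exact pow_right_mem_pairSpan h (by omega)

lemma span_le_of_subset_subalgebra {D : Subalgebra F R} {N : Submodule A R}
    (hN : ∀ f, f ∈ N ↔ f ∈ D) {a b : R} (ha : a ∈ D) (hb : b ∈ D) (q : ℕ) :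
    pairSpan A a b q ≤ N := by
  refine Submodule.span_le.2 ?_
  rintro _ (⟨i, _, rfl⟩ | ⟨j, _, rfl⟩)
  · exact (hN _).2 (pow_mem ha _)
  · exact (hN _).2 (pow_mem hb _)

lemma powersBelow_le_of_subalgebra {D : Subalgebra F R} {N : Submodule A R}
    (hN : ∀ f, f ∈ N ↔ f ∈ D) {u : R} (hu : u ∈ D) (n : ℕ) : powersBelow A u n ≤ N := by
  refine Submodule.span_le.2 ?_
  rintro _ ⟨i, _, rfl⟩
  exact (hN _).2 (pow_mem hu _)

lemma mul_le_of_subalgebra {D : Subalgebra F R} {N P Q : Submodule A R}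
    (hN : ∀ f, f ∈ N ↔ f ∈ D) (hP : P ≤ N) (hQ : Q ≤ N) : P * Q ≤ N :=
  Submodule.mul_le.2 fun _ hm _ hn => (hN _).2 (mul_mem ((hN _).1 (hP hm)) ((hN _).1 (hQ hn)))

end spanning

section dickson

variable {F : Type} [Field F] [Fintype F]

lemma d22_eq : d22 F (Fintype.card F) = -(X 0 * phi2 F (Fintype.card F)) := by
  obtain ⟨m, hm⟩ : ∃ m, Fintype.card F = m + 1 := ⟨_, (Nat.sub_add_cancel Fintype.card_pos).symm⟩
  rw [d22, phi2, hm, Nat.add_sub_cancel]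
  ring

lemma d22s_eq : d22s F (Fintype.card F) = -(X 3 * phi2s F (Fintype.card F)) := by
  obtain ⟨m, hm⟩ : ∃ m, Fintype.card F = m + 1 := ⟨_, (Nat.sub_add_cancel Fintype.card_pos).symm⟩
  rw [d22s, phi2s, hm, Nat.add_sub_cancel]
  ring

lemma sub_pow_card {R : Type} [CommRing R] [Algebra F R] (a b : R) :
    (a - b) ^ Fintype.card F = a ^ Fintype.card F - b ^ Fintype.card F :=
  map_sub (FiniteField.frobeniusAlgHom F R) a b

lemma dickson_identity {R : Type} [CommRing R] [Algebra F R] (x y : R) :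
    -(x * (y ^ Fintype.card F - y * x ^ (Fintype.card F - 1))) *
      ((y ^ Fintype.card F - y * x ^ (Fintype.card F - 1)) ^ (Fintype.card F - 1) +
        x ^ (Fintype.card F * (Fintype.card F - 1))) =
      y * x ^ (Fintype.card F ^ 2) - x * y ^ (Fintype.card F ^ 2) := by
  have h := sub_pow_card (F := F) (y ^ Fintype.card F) (y * x ^ (Fintype.card F - 1))
  obtain ⟨m, hm⟩ : ∃ m, Fintype.card F = m + 1 := ⟨_, (Nat.sub_add_cancel Fintype.card_pos).symm⟩
  rw [hm, Nat.add_sub_cancel] at h ⊢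
  rw [pow_succ _ m] at h
  linear_combination (-x) * h

lemma phi2_ne_zero : phi2 F (Fintype.card F) ≠ 0 := by
  intro h
  have := congrArg (aeval ![0, 1, 0, 0] : R2 F →ₐ[F] F) h
  have h1 := Fintype.one_lt_card (α := F)
  simp [phi2] at this
  rw [zero_pow (by omega), sub_zero] at this
  exact one_ne_zero this

lemma phi2s_ne_zero : phi2s F (Fintype.card F) ≠ 0 := by
  intro h
  have := congrArg (aeval ![0, 0, 1, 0] : R2 F →ₐ[F] F) h
  have h1 := Fintype.one_lt_card (α := F)
  simp [phi2s] at this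
  rw [zero_pow (by omega), sub_zero] at this
  exact one_ne_zero this

lemma c21_eq {c21 : R2 F} (h : d22 F (Fintype.card F) * c21 =
      X 1 * X 0 ^ (Fintype.card F ^ 2) - X 0 * X 1 ^ (Fintype.card F ^ 2)) :
    c21 = phi2 F (Fintype.card F) ^ (Fintype.card F - 1) +
      X 0 ^ (Fintype.card F * (Fintype.card F - 1)) := by
  have h0 : d22 F (Fintype.card F) ≠ 0 := by
    rw [d22_eq]
    exact neg_ne_zero.2 (mul_ne_zero (X_ne_zero 0) phi2_ne_zero)
  refine mul_left_cancel₀ h0 (h.trans ?_)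
  rw [d22_eq]
  exact (dickson_identity (F := F) (X 0 : R2 F) (X 1)).symm

lemma c21s_eq {c21s : R2 F} (h : d22s F (Fintype.card F) * c21s =
      X 2 * X 3 ^ (Fintype.card F ^ 2) - X 3 * X 2 ^ (Fintype.card F ^ 2)) :
    c21s = phi2s F (Fintype.card F) ^ (Fintype.card F - 1) +
      X 3 ^ (Fintype.card F * (Fintype.card F - 1)) := by
  have h0 : d22s F (Fintype.card F) ≠ 0 := by
    rw [d22s_eq]
    exact neg_ne_zero.2 (mul_ne_zero (X_ne_zero 3) phi2s_ne_zero)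
  refine mul_left_cancel₀ h0 (h.trans ?_)
  rw [d22s_eq]
  exact (dickson_identity (F := F) (X 3 : R2 F) (X 2)).symm

variable {A : Subalgebra F (R2 F)}
  (hd : d22 F (Fintype.card F) ∈ A)
  (hc : phi2 F (Fintype.card F) ^ (Fintype.card F - 1) +
    X 0 ^ (Fintype.card F * (Fintype.card F - 1)) ∈ A)
  (hds : d22s F (Fintype.card F) ∈ A)
  (hcs : phi2s F (Fintype.card F) ^ (Fintype.card F - 1) +
    X 3 ^ (Fintype.card F * (Fintype.card F - 1)) ∈ A)

/-- Module generators of the algebra generated by `x₁, φ₂, y₂, φ₂*`. -/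
def baseSpan (A : Subalgebra F (R2 F)) : Submodule A (R2 F) :=
  pairSpan A (X 0) (phi2 F (Fintype.card F)) (Fintype.card F) *
    pairSpan A (X 3) (phi2s F (Fintype.card F)) (Fintype.card F)

lemma exists_card_le_baseSpan (A : Subalgebra F (R2 F)) : ∃ S : Finset (R2 F),
    S.card ≤ (Fintype.card F ^ 2 - 1) * (Fintype.card F ^ 2 - 1) ∧
      Submodule.span A (S : Set (R2 F)) = baseSpan A :=
  exists_card_le_mul (exists_card_le_pairSpan _ _ Fintype.one_lt_card)
    (exists_card_le_pairSpan _ _ Fintype.one_lt_card)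

lemma one_mem_baseSpan (A : Subalgebra F (R2 F)) : 1 ∈ baseSpan A := by
  have := Submodule.mul_mem_mul
    (one_mem_pairSpan (A := A) (X 0) (phi2 F (Fintype.card F)) (Fintype.card F))
    (one_mem_pairSpan (A := A) (X 3) (phi2s F (Fintype.card F)) (Fintype.card F))
  rwa [one_mul] at this

lemma mem_of_d22_mem {A : Subalgebra F (R2 F)} (hd : d22 F (Fintype.card F) ∈ A) :
    X 0 * phi2 F (Fintype.card F) ∈ A := by
  rw [d22_eq] at hd
  simpa using neg_mem hd

lemma mem_of_d22s_mem {A : Subalgebra F (R2 F)} (hd : d22s F (Fintype.card F) ∈ A) :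
    X 3 * phi2s F (Fintype.card F) ∈ A := by
  rw [d22s_eq] at hd
  simpa using neg_mem hd

include hd hc hds hcs

lemma baseGens_subset_multipliers :
    X 0 ∈ multipliers (baseSpan A) ∧ phi2 F (Fintype.card F) ∈ multipliers (baseSpan A) ∧
    X 3 ∈ multipliers (baseSpan A) ∧ phi2s F (Fintype.card F) ∈ multipliers (baseSpan A) :=
  have hq : 2 ≤ Fintype.card F := Fintype.one_lt_card
  ⟨multipliers_le_mul_left _ _ (left_mem_multipliers_pairSpan hq (mem_of_d22_mem hd) hc),
    multipliers_le_mul_left _ _ (right_mem_multipliers_pairSpan hq (mem_of_d22_mem hd) hc),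
    multipliers_le_mul_right _ _ (left_mem_multipliers_pairSpan hq (mem_of_d22s_mem hds) hcs),
    multipliers_le_mul_right _ _ (right_mem_multipliers_pairSpan hq (mem_of_d22s_mem hds) hcs)⟩

lemma exists_span_eq_top : ∃ S : Finset (R2 F),
    S.card ≤ (Fintype.card F ^ 2 - 1) * (Fintype.card F ^ 2 - 1) *
      Fintype.card F * Fintype.card F ∧
      Submodule.span A (S : Set (R2 F)) = ⊤ := by
  have hq : 2 ≤ Fintype.card F := Fintype.one_lt_card
  obtain ⟨h0, h1, h3, h2⟩ := baseGens_subset_multipliers hd hc hds hcs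
  obtain ⟨S, hS, hspan⟩ := exists_card_le_mul (exists_card_le_mul (exists_card_le_baseSpan A)
    (exists_card_le_powersBelow (X 1) (Fintype.card F)))
    (exists_card_le_powersBelow (X 2) (Fintype.card F))
  refine ⟨S, hS, ?_⟩
  rw [hspan, eq_top_iff]
  intro f _
  have hf : f ∈ Algebra.adjoin F (Set.range X) := by rw [adjoin_range_X]; trivial
  refine mem_of_mem_adjoin (one_mem_mul_powersBelow (one_mem_mul_powersBelow
    (one_mem_baseSpan A) (by omega)) (by omega)) ?_ hf
  rintro _ ⟨i, rfl⟩
  have hX1 : X 1 ∈ multipliers (baseSpan A * powersBelow A (X 1) (Fintype.card F)) :=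
    mul_mem_mul_powersBelow hq h1 (pow_mem h0 (Fintype.card F - 1)) (by rw [phi2]; ring)
  have hX2 : X 2 ∈ multipliers (baseSpan A * powersBelow A (X 1) (Fintype.card F) *
      powersBelow A (X 2) (Fintype.card F)) :=
    mul_mem_mul_powersBelow hq (multipliers_le_mul_left _ _ h2)
      (pow_mem (multipliers_le_mul_left _ _ h3) (Fintype.card F - 1)) (by rw [phi2s]; ring)
  fin_cases i
  · exact multipliers_le_mul_left _ _ (multipliers_le_mul_left _ _ h0)
  · exact multipliers_le_mul_left _ _ hX1
  · exact hX2
  · exact multipliers_le_mul_left _ _ (multipliers_le_mul_left _ _ h3)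

lemma exists_span_eq_invariants {N : Submodule A (R2 F)}
    (hN : ∀ f, f ∈ N ↔ f ∈ invariantRing (P2 F)) : ∃ S : Finset (R2 F),
    S.card ≤ (Fintype.card F ^ 2 - 1) * (Fintype.card F ^ 2 - 1) * Fintype.card F ∧
      N = Submodule.span A (S : Set (R2 F)) := by
  have hq : 2 ≤ Fintype.card F := Fintype.one_lt_card
  obtain ⟨h0, h1, h3, h2⟩ := baseGens_subset_multipliers hd hc hds hcs
  obtain ⟨S, hS, hspan⟩ := exists_card_le_mul (exists_card_le_baseSpan A)
    (exists_card_le_powersBelow (u0 F) (Fintype.card F))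
  refine ⟨S, hS, ?_⟩
  rw [hspan]
  refine le_antisymm ?_ ?_
  · intro f hf
    refine mem_of_mem_adjoin (one_mem_mul_powersBelow (one_mem_baseSpan A) (by omega)) ?_
      (mem_adjoin_of_mem_invariantRing ((hN f).1 hf))
    intro g hg
    simp only [unipotentGens, Set.mem_insert_iff, Set.mem_singleton_iff] at hg
    rcases hg with rfl | rfl | rfl | rfl | rfl
    · exact multipliers_le_mul_left _ _ h0
    · exact multipliers_le_mul_left _ _ h1
    · exact multipliers_le_mul_left _ _ h2
    · exact multipliers_le_mul_left _ _ h3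
    · exact mul_mem_mul_powersBelow hq
        (add_mem (mul_mem (pow_mem h0 _) h2) (mul_mem (pow_mem h3 _) h1))
        (pow_mem (mul_mem h0 h3) _) u0_pow_card
  · have hmem : ∀ g ∈ unipotentGens F, g ∈ invariantRing (P2 F) := by
      intro g hg
      rw [mem_invariantRing_iff P2_le_SL2]
      rintro B ⟨hB0, hB1, hB2⟩
      have hpow := smul_pow_card (B.val 0 1) (X 0 : R2 F)
      have hpow' := smul_pow_card (B.val 0 1) (X 3 : R2 F)
      simp only [unipotentGens, Set.mem_insert_iff, Set.mem_singleton_iff] at hg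
      rcases hg with rfl | rfl | rfl | rfl | rfl <;>
        simp only [phi2, phi2s, u0, map_sub, map_add, map_mul, map_pow, pairAct_X0, pairAct_X1,
          pairAct_X2, pairAct_X3, hB0, hB1, hB2, C_0, C_1, one_mul, zero_mul, sub_zero, zero_add,
          sub_pow_card, add_pow_card, ← smul_eq_C_mul, hpow, hpow']
      all_goals
        simp only [smul_eq_C_mul]
        ring
    refine mul_le_of_subalgebra hN (mul_le_of_subalgebra hN
      (span_le_of_subset_subalgebra hN ?_ ?_ _) (span_le_of_subset_subalgebra hN ?_ ?_ _))
      (powersBelow_le_of_subalgebra hN ?_ _) <;>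
    exact hmem _ (by simp [unipotentGens])

end dickson

/-! ### Transfer -/

lemma exists_transfer {F R Γ : Type} [Field F] [CommRing R] [Algebra F R] [Group Γ]
    (φ : Γ →* (R ≃ₐ[F] R)) (P : Subgroup Γ) [Finite (Γ ⧸ P)] (hP : (P.index : F) ≠ 0)
    (A : Subalgebra F R) (hA : ∀ a ∈ A, ∀ g, φ g a = a) :
    ∃ π : R →ₗ[A] R, (∀ n, (∀ g ∈ P, φ g n = n) → ∀ g, φ g (π n) = π n) ∧
      ∀ m, (∀ g, φ g m = m) → π m = m := by
  have := Fintype.ofFinite (Γ ⧸ P)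
  let ψ : (Γ ⧸ P) → (R →ₗ[A] R) := fun x =>
    { toFun := φ x.out
      map_add' := map_add _
      map_smul' := fun a f => by
        rw [Subalgebra.smul_def, smul_eq_mul, map_mul, hA a a.2]
        rfl }
  have hψ : ∀ x f, ψ x f = φ x.out f := fun _ _ => rfl
  refine ⟨algebraMap F A (P.index : F)⁻¹ • ∑ x, ψ x, ?_, ?_⟩
  · intro n hn g
    have hc : ∀ f : R, algebraMap F A (P.index : F)⁻¹ • f = (P.index : F)⁻¹ • f := fun f => by
      rw [algebraMap_smul]
    rw [LinearMap.smul_apply, hc, map_smul, LinearMap.sum_apply, map_sum]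
    congr 1
    refine Fintype.sum_equiv (MulAction.toPerm g) _ _ fun x => ?_
    rw [hψ, hψ, MulAction.toPerm_apply]
    have hx : g • x = ((g * x.out : Γ) : Γ ⧸ P) := by
      conv_lhs => rw [← QuotientGroup.out_eq' x]
      rfl
    obtain ⟨h, hh⟩ := QuotientGroup.mk_out_eq_mul P (g * x.out)
    rw [hx, hh, map_mul, map_mul, AlgEquiv.mul_apply, AlgEquiv.mul_apply, hn h h.2]
  · intro m hm
    rw [LinearMap.smul_apply, LinearMap.sum_apply, algebraMap_smul]
    simp only [hψ, hm]
    rw [Finset.sum_const, Finset.card_univ, ← Nat.card_eq_fintype_card, ← Subgroup.index,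
      ← Nat.cast_smul_eq_nsmul F, smul_smul, inv_mul_cancel₀ hP, one_smul]

section invariants

variable {F : Type} [Field F]

lemma homogeneousComponent_pairAct (A B : GL (Fin 2) F) (f : R2 F) (n : ℕ) :
    homogeneousComponent n (pairAct A B f) = pairAct A B (homogeneousComponent n f) := by
  have hmap : ∀ p, Polynomial.mapAlgHom (pairAct A B) p =
      p.map (pairAct A B : R2 F →+* R2 F) := fun _ => rfl
  have h : (homogenizing (Fin 4) F).comp (pairAct A B) =
      (Polynomial.mapAlgHom (pairAct A B)).comp (homogenizing (Fin 4) F) := by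
    have hC : ∀ c : F, homogenizing (Fin 4) F (C c) = Polynomial.C (C c) := fun c => by
      rw [← algebraMap_eq, AlgHom.commutes]
      rfl
    have hX : ∀ i, homogenizing (Fin 4) F (X i) = Polynomial.C (X i) * Polynomial.X := fun i => by
      rw [homogenizing, aeval_X]
    ext1 i
    rw [AlgHom.comp_apply, AlgHom.comp_apply, hX, map_mul, hmap, hmap, Polynomial.map_X, Polynomial.map_C, RingHom.coe_coe]
    fin_cases i <;>
    simp only [Fin.zero_eta, Fin.mk_one, Fin.reduceFinMk, pairAct_X0, pairAct_X1,
      pairAct_X2, pairAct_X3, map_sub, map_add, map_mul, hC, hX] <;>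
    ring
  rw [← coeff_homogenizing, ← coeff_homogenizing, ← AlgHom.comp_apply, h, AlgHom.comp_apply,
    hmap, Polynomial.coeff_map]
  rfl

lemma isGraded_invariantRing {G : Subgroup (GL (Fin 2) F)} (hG : G ≤ SL2 F) :
    IsGraded (invariantRing G : Set (R2 F)) := by
  intro f hf n
  rw [SetLike.mem_coe, mem_invariantRing_iff hG] at hf ⊢
  intro A hA
  rw [← homogeneousComponent_pairAct, hf A hA]

/-- An algebra of invariants as a module over a smaller algebra. -/
def invariantModule {A D : Subalgebra F (R2 F)} (h : A ≤ D) : Submodule A (R2 F) where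
  carrier := D
  add_mem' := add_mem
  zero_mem' := zero_mem _
  smul_mem' := fun a _ hx => mul_mem (h a.2) hx

lemma mem_invariantModule {A D : Subalgebra F (R2 F)} (h : A ≤ D) (f : R2 F) :
    f ∈ invariantModule h ↔ f ∈ D := Iff.rfl

lemma pairAct_frobenius_x {A B : GL (Fin 2) F} (hA : A ∈ SL2 F) {n : ℕ}
    (hn : ∀ f g : R2 F, (f - g) ^ n = f ^ n - g ^ n) (hF : ∀ c : F, c ^ n = c) :
    pairAct A B (X 1 * X 0 ^ n - X 0 * X 1 ^ n) = X 1 * X 0 ^ n - X 0 * X 1 ^ n := by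
  have hdet : A.val.det = 1 := hA
  rw [Matrix.det_fin_two] at hdet
  have hdet' := congrArg (C : F → R2 F) hdet
  simp only [C_sub, C_mul, C_1] at hdet'
  simp only [map_sub, map_mul, map_pow, pairAct_X0, pairAct_X1, hn, mul_pow, ← C_pow, hF]
  linear_combination (X 1 * X 0 ^ n - X 0 * X 1 ^ n) * hdet'

lemma pairAct_frobenius_y {A B : GL (Fin 2) F} (hB : B ∈ SL2 F) {n : ℕ}
    (hn : ∀ f g : R2 F, (f + g) ^ n = f ^ n + g ^ n) (hF : ∀ c : F, c ^ n = c) :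
    pairAct A B (X 2 * X 3 ^ n - X 3 * X 2 ^ n) = X 2 * X 3 ^ n - X 3 * X 2 ^ n := by
  have hdet : B.val.det = 1 := hB
  rw [Matrix.det_fin_two] at hdet
  have hdet' := congrArg (C : F → R2 F) hdet
  simp only [C_sub, C_mul, C_1] at hdet'
  simp only [map_sub, map_mul, map_pow, pairAct_X2, pairAct_X3, hn, mul_pow, ← C_pow, hF]
  linear_combination (X 2 * X 3 ^ n - X 3 * X 2 ^ n) * hdet'

variable [Fintype F]

lemma isHomogeneous_d22 : (d22 F (Fintype.card F)).IsHomogeneous (Fintype.card F + 1) := by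
  have h0 := isHomogeneous_X F (0 : Fin 4)
  have h1 := isHomogeneous_X F (1 : Fin 4)
  refine IsHomogeneous.sub ?_ ?_
  · have h := h1.mul (h0.pow (Fintype.card F))
    rwa [one_mul, add_comm] at h
  · have h := h0.mul (h1.pow (Fintype.card F))
    rwa [one_mul, add_comm] at h

lemma isHomogeneous_d22s : (d22s F (Fintype.card F)).IsHomogeneous (Fintype.card F + 1) := by
  have h0 := isHomogeneous_X F (3 : Fin 4)
  have h1 := isHomogeneous_X F (2 : Fin 4)
  refine IsHomogeneous.sub ?_ ?_
  · have h := h1.mul (h0.pow (Fintype.card F))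
    rwa [one_mul, add_comm] at h
  · have h := h0.mul (h1.pow (Fintype.card F))
    rwa [one_mul, add_comm] at h

lemma isHomogeneous_dickson (i j : Fin 4) :
    ((X j ^ Fintype.card F - X j * X i ^ (Fintype.card F - 1) : R2 F) ^ (Fintype.card F - 1) +
      X i ^ (Fintype.card F * (Fintype.card F - 1))).IsHomogeneous
      (Fintype.card F * (Fintype.card F - 1)) := by
  have hi := isHomogeneous_X F i
  have hj := isHomogeneous_X F j
  have hq := Fintype.card_pos (α := F)
  refine IsHomogeneous.add (IsHomogeneous.pow (IsHomogeneous.sub ?_ ?_) _) ?_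
  · simpa using hj.pow (Fintype.card F)
  · have h := hj.mul (hi.pow (Fintype.card F - 1))
    rwa [one_mul, Nat.add_sub_cancel' hq] at h
  · simpa using hi.pow (Fintype.card F * (Fintype.card F - 1))

lemma index_subgroupOf :
    ((P2 F).subgroupOf (SL2 F)).index = Fintype.card F ^ 2 - 1 := by
  have h1 := Subgroup.card_mul_index ((P2 F).subgroupOf (SL2 F))
  rw [Nat.card_congr (Subgroup.subgroupOfEquivOfLe P2_le_SL2).toEquiv, card_P2, card_SL2,
    Nat.card_eq_fintype_card] at h1
  exact Nat.eq_of_mul_eq_mul_left Fintype.card_pos h1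

lemma exists_transfer_invariantRing {A : Subalgebra F (R2 F)} (hA : A ≤ pairInvariants F) :
    ∃ π : R2 F →ₗ[A] R2 F,
      (∀ f ∈ invariantRing (P2 F), π f ∈ invariantRing (SL2 F)) ∧
      ∀ f ∈ invariantRing (SL2 F), π f = f := by
  have hindex : (((P2 F).subgroupOf (SL2 F)).index : F) ≠ 0 := by
    rw [index_subgroupOf, Nat.cast_sub (Nat.one_le_pow _ _ Fintype.card_pos)]
    simp
  have : Finite (SL2 F) := Subtype.finite
  have hmem : ∀ f, f ∈ invariantRing (SL2 F) ↔ ∀ g : SL2 F,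
      (pairAut.comp ((SL2 F).subtype.prod (SL2 F).subtype)) g f = f := by
    intro f
    rw [mem_invariantRing_iff le_rfl]
    constructor
    · exact fun h g => h _ (inv_mem g.2)
    · intro h B hB
      simpa [pairAut_apply] using h (⟨B, hB⟩ : SL2 F)⁻¹
  obtain ⟨π, h1, h2⟩ := exists_transfer (pairAut.comp ((SL2 F).subtype.prod (SL2 F).subtype))
    ((P2 F).subgroupOf (SL2 F)) hindex A
    fun a ha g => hA ha _ (inv_mem g.2) _ (inv_mem g.2)
  refine ⟨π, fun f hf => (hmem _).2 (h1 f ?_), fun f hf => h2 f ((hmem f).1 hf)⟩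
  intro g hg
  exact (mem_invariantRing_iff P2_le_SL2 f).1 hf _ (inv_mem (Subgroup.mem_subgroupOf.1 hg))

lemma adjoin_le_pairInvariants {c21 c21s : R2 F}
    (hc21 : d22 F (Fintype.card F) * c21 =
      X 1 * X 0 ^ (Fintype.card F ^ 2) - X 0 * X 1 ^ (Fintype.card F ^ 2))
    (hc21s : d22s F (Fintype.card F) * c21s =
      X 2 * X 3 ^ (Fintype.card F ^ 2) - X 3 * X 2 ^ (Fintype.card F ^ 2)) :
    Algebra.adjoin F {d22 F (Fintype.card F), c21, d22s F (Fintype.card F), c21s} ≤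
      pairInvariants F := by
  have hd : d22 F (Fintype.card F) ∈ pairInvariants F := fun A hA B hB =>
    pairAct_frobenius_x hA sub_pow_card FiniteField.pow_card
  have hds : d22s F (Fintype.card F) ∈ pairInvariants F := fun A hA B hB =>
    pairAct_frobenius_y hB add_pow_card FiniteField.pow_card
  have hpow : ∀ c : F, c ^ (Fintype.card F ^ 2) = c := fun c => by
    rw [sq, pow_mul, FiniteField.pow_card, FiniteField.pow_card]
  refine Algebra.adjoin_le ?_
  intro f hf
  simp only [Set.mem_insert_iff, Set.mem_singleton_iff] at hf
  rcases hf with rfl | rfl | rfl | rfl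
  · exact hd
  · intro A hA B hB
    have h0 : d22 F (Fintype.card F) ≠ 0 := by
      rw [d22_eq]
      exact neg_ne_zero.2 (mul_ne_zero (X_ne_zero 0) phi2_ne_zero)
    refine mul_left_cancel₀ h0 ?_
    have h := congrArg (pairAct A B) hc21
    rw [map_mul, hd A hA B hB, pairAct_frobenius_x hA (fun f g => by
      simp only [sq, pow_mul, sub_pow_card]) hpow] at h
    rw [h, hc21]
  · exact hds
  · intro A hA B hB
    have h0 : d22s F (Fintype.card F) ≠ 0 := by
      rw [d22s_eq]
      exact neg_ne_zero.2 (mul_ne_zero (X_ne_zero 3) phi2s_ne_zero)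
    refine mul_left_cancel₀ h0 ?_
    have h := congrArg (pairAct A B) hc21s
    rw [map_mul, hds A hA B hB, pairAct_frobenius_y hB (fun f g => by
      simp only [sq, pow_mul, add_pow_card]) hpow] at h
    rw [h, hc21s]

end invariants

/-- `R₂^{SL₂}` is a free module over the subalgebra
`𝒜 = F_q[d₂₂, c₂₁, d₂₂*, c₂₁*]` of rank `q(q²−1)`. -/
theorem stmt_1 (q : ℕ) (hq : IsPrimePow q) (F : Type) [Field F] [Fintype F]
    (hF : Fintype.card F = q)
    (c21 c21s : R2 F)
    (hc21 : d22 F q * c21 = X 1 * X 0 ^ (q ^ 2) - X 0 * X 1 ^ (q ^ 2))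
    (hc21s : d22s F q * c21s = X 2 * X 3 ^ (q ^ 2) - X 3 * X 2 ^ (q ^ 2)) :
    ∃ B : Finset (R2 F),
      B.card = q * (q ^ 2 - 1) ∧
      (B : Set (R2 F)) ⊆ (invariantRing (SL2 F) : Set (R2 F)) ∧
      (∀ f ∈ invariantRing (SL2 F),
        f ∈ Submodule.span (Algebra.adjoin F {d22 F q, c21, d22s F q, c21s})
          (B : Set (R2 F))) ∧
      LinearIndependent (Algebra.adjoin F {d22 F q, c21, d22s F q, c21s})
        (fun b : (B : Set (R2 F)) => (b : R2 F)) := by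
  subst hF
  set A := Algebra.adjoin F {d22 F (Fintype.card F), c21, d22s F (Fintype.card F), c21s} with hAdef
  have hAinv : A ≤ pairInvariants F := adjoin_le_pairInvariants hc21 hc21s
  have hd : d22 F (Fintype.card F) ∈ A := Algebra.subset_adjoin (by simp)
  have hds : d22s F (Fintype.card F) ∈ A := Algebra.subset_adjoin (by simp)
  have hc : c21 ∈ A := Algebra.subset_adjoin (by simp)
  have hcs : c21s ∈ A := Algebra.subset_adjoin (by simp)
  rw [c21_eq hc21] at hc
  rw [c21s_eq hc21s] at hcs
  have hA : IsGraded (A : Set (R2 F)) := by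
    refine isGraded_adjoin fun f hf => ?_
    simp only [Set.mem_insert_iff, Set.mem_singleton_iff] at hf
    rcases hf with rfl | rfl | rfl | rfl
    · exact ⟨_, isHomogeneous_d22⟩
    · rw [c21_eq hc21]
      exact ⟨_, isHomogeneous_dickson 0 1⟩
    · exact ⟨_, isHomogeneous_d22s⟩
    · rw [c21s_eq hc21s]
      exact ⟨_, isHomogeneous_dickson 3 2⟩
  clear_value A
  have hAM : A ≤ invariantRing (SL2 F) := hAinv.trans (pairInvariants_le_invariantRing le_rfl)
  have hAN : A ≤ invariantRing (P2 F) := hAinv.trans (pairInvariants_le_invariantRing P2_le_SL2)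
  have hq := Fintype.one_lt_card (α := F)
  have hq2 : 0 < Fintype.card F ^ 2 - 1 := Nat.sub_pos_of_lt (Nat.one_lt_pow two_ne_zero hq)
  have hrank : Module.finrank A (R2 F) =
      (Fintype.card F * (Fintype.card F ^ 2 - 1)) ^ 2 := by
    obtain ⟨S, hS, hspan⟩ := exists_span_eq_top hd hc hds hcs
    have h1 := finrank_le_card_of_span A S hspan
    have h2 := finrank_pos_of_span A S hspan
    have h3 := finrank_mul_finrank_of_le hAinv (invariantModule hAinv) (mem_invariantModule hAinv)
    rw [← card_sq_eq_finrank_pairInvariants, card_SL2] at h3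
    refine le_antisymm ((h1.trans hS).trans (le_of_eq (by ring))) ?_
    rw [← h3] at h2 ⊢
    exact Nat.le_mul_of_pos_left _ (Nat.pos_of_mul_pos_right h2)
  have hrankM : Module.finrank A (invariantModule hAM) =
      Fintype.card F * (Fintype.card F ^ 2 - 1) := by
    have h := finrank_mul_finrank_of_le hAM (invariantModule hAM) (mem_invariantModule hAM)
    rw [← card_eq_finrank_invariantRing le_rfl, hrank, card_SL2,
      sq (Fintype.card F * (Fintype.card F ^ 2 - 1))] at h
    exact Nat.eq_of_mul_eq_mul_right (Nat.mul_pos (by omega) hq2) h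
  have hrankN : Module.finrank A (invariantModule hAN) =
      (Fintype.card F ^ 2 - 1) * (Fintype.card F ^ 2 - 1) * Fintype.card F := by
    have h := finrank_mul_finrank_of_le hAN (invariantModule hAN) (mem_invariantModule hAN)
    rw [← card_eq_finrank_invariantRing P2_le_SL2, hrank, card_P2, Nat.card_eq_fintype_card] at h
    refine Nat.eq_of_mul_eq_mul_right (Fintype.card_pos (α := F)) (h.trans ?_)
    ring
  obtain ⟨S, hS, hNS⟩ := exists_span_eq_invariants hd hc hds hcs (mem_invariantModule hAN)
  obtain ⟨π, hπN, hπM⟩ := exists_transfer_invariantRing hAinv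
  have hMN : invariantModule hAM ≤ invariantModule hAN := fun f hf A hA => hf A (P2_le_SL2 hA)
  obtain ⟨B, hBM, hMB, hB⟩ := exists_linearIndependent_span_of_retract hA hMN
    (isGraded_invariantRing le_rfl) (isGraded_invariantRing P2_le_SL2) π hπN hπM S hNS
    (hS.trans hrankN.ge)
  refine ⟨B, ?_, hBM, hMB, hB⟩
  have hspan : Submodule.span A (B : Set (R2 F)) = invariantModule hAM :=
    le_antisymm (Submodule.span_le.2 hBM) hMB
  rw [← hrankM, ← hspan]
  have := linearIndependent_iff_card_eq_finrank_span.1 hB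
  rw [Set.finrank, Subtype.range_coe] at this
  simpa using this
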